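/- Let μ and ν be Borel probability measures on ℝⁿ with finite second moments. Let R ⊂ ℝⁿ be a closed cube with side length ℓ(R) ≥ c₅, and suppose μ(int R) > 0 and ν(int R) > 0. Assume μ⌊R = f(x)dx with c₄⁻¹ ≤ f(x) ≤ c₄ for a.e. x ∈ R. If φ ∈ 𝒢(R) (with constant c₂), then W₂(φμ, a·φν) ≤ c·W₂(μ,ν), where a > 0 is chosen so that ∫φ dμ = a∫φ dν and c depends only on n, c₂, c₄ and c₅. -/

import Mathlib

open MeasureTheory Metric Set ENNReal
open scoped NNReal

noncomputable section

/-- The `p`-th Wasserstein distance between two measures, as a value in `ℝ≥0∞`. -/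
def Wp {E : Type*} [EMetricSpace E] [MeasurableSpace E] (p : ℝ) (μ ν : Measure E) : ℝ≥0∞ :=
  ⨅ π ∈ {π : Measure (E × E) | π.map Prod.fst = μ ∧ π.map Prod.snd = ν},
    (∫⁻ z, edist z.1 z.2 ^ p ∂π) ^ (1 / p)

/-- The closed axis-parallel cube with lower corner `z` and side length `l`. -/
def cube {n : ℕ} (z : EuclideanSpace ℝ (Fin n)) (l : ℝ) : Set (EuclideanSpace ℝ (Fin n)) :=
  {x | ∀ i, x i ∈ Icc (z i) (z i + l)}

/-- The open cube with lower corner `z` and side length `l` (the interior of `cube z l`). -/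
def ocube {n : ℕ} (z : EuclideanSpace ℝ (Fin n)) (l : ℝ) : Set (EuclideanSpace ℝ (Fin n)) :=
  {x | ∀ i, x i ∈ Ioo (z i) (z i + l)}

/-- For `x` in the cube `cube z l`, `bdist z l x` is the (euclidean) distance from `x`
to the boundary of the cube. -/
def bdist {n : ℕ} (z : EuclideanSpace ℝ (Fin n)) (l : ℝ) (x : EuclideanSpace ℝ (Fin n)) : ℝ :=
  ⨅ i, min (x i - z i) (z i + l - x i)

/-- The distance from `x` to the face of `cube z l` indexed by coordinate `i` and
side `b` (`b = false`: lower face, `b = true`: upper face), for `x` in the cube. -/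
def facedist {n : ℕ} (z : EuclideanSpace ℝ (Fin n)) (l : ℝ) (x : EuclideanSpace ℝ (Fin n))
    (i : Fin n) (b : Bool) : ℝ :=
  if b then z i + l - x i else x i - z i

/-- `φ ∈ 𝒢(R)` for the cube `R = cube z l`, with constant `c₂`: `φ : R → [0,1]` is Lipschitz
(extended by `0` outside `R`), `c₂⁻¹ dist(x,∂R)²/ℓ(R)² ≤ φ(x) ≤ c₂ dist(x,∂R)²/ℓ(R)²`,
`|∇φ(x)| ≤ c₂ dist(x,∂R)/ℓ(R)²`, and the tangential gradient (along the unique closest face,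
when it exists) satisfies `|∇_T φ(x)| ≤ c₂ dist(x,∂R)²/ℓ(R)³`. -/
def memG {n : ℕ} (c₂ : ℝ) (z : EuclideanSpace ℝ (Fin n)) (l : ℝ)
    (φ : EuclideanSpace ℝ (Fin n) → ℝ) : Prop :=
  (∃ K : ℝ≥0, LipschitzWith K φ) ∧
  (∀ x, φ x ∈ Icc (0:ℝ) 1) ∧
  (∀ x, x ∉ cube z l → φ x = 0) ∧
  (∀ x ∈ cube z l,
      c₂⁻¹ * bdist z l x ^ 2 / l ^ 2 ≤ φ x ∧ φ x ≤ c₂ * bdist z l x ^ 2 / l ^ 2) ∧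
  (∀ x ∈ cube z l, DifferentiableAt ℝ φ x →
      ‖fderiv ℝ φ x‖ ≤ c₂ * bdist z l x / l ^ 2) ∧
  (∀ x ∈ cube z l, DifferentiableAt ℝ φ x →
      ∀ (i : Fin n) (b : Bool),
        (∀ (j : Fin n) (b' : Bool), (j, b') ≠ (i, b) →
          facedist z l x i b < facedist z l x j b') →
        ∀ v : EuclideanSpace ℝ (Fin n), v i = 0 → ‖v‖ ≤ 1 →
          |fderiv ℝ φ x v| ≤ c₂ * bdist z l x ^ 2 / l ^ 3)

open ProbabilityTheory

/-- The optimal quadratic transport cost between two measures, i.e. the square of `Wp 2`. -/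
def transportCost {X : Type*} [EMetricSpace X] [MeasurableSpace X] (μ ν : Measure X) : ℝ≥0∞ :=
  ⨅ π ∈ {π : Measure (X × X) | π.map Prod.fst = μ ∧ π.map Prod.snd = ν},
    ∫⁻ z, edist z.1 z.2 ^ 2 ∂π

section TransportCost

variable {X Y : Type*} [EMetricSpace X] [MeasurableSpace X] [EMetricSpace Y] [MeasurableSpace Y]

lemma transportCost_le {μ ν : Measure X} (π : Measure (X × X)) (h1 : π.map Prod.fst = μ)
    (h2 : π.map Prod.snd = ν) : transportCost μ ν ≤ ∫⁻ z, edist z.1 z.2 ^ 2 ∂π :=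
  iInf₂_le π ⟨h1, h2⟩

lemma exists_coupling_of_transportCost_lt {μ ν : Measure X} {c : ℝ≥0∞}
    (h : transportCost μ ν < c) :
    ∃ π : Measure (X × X), π.map Prod.fst = μ ∧ π.map Prod.snd = ν ∧
      ∫⁻ z, edist z.1 z.2 ^ 2 ∂π < c := by
  simp only [transportCost, iInf_lt_iff] at h
  obtain ⟨π, ⟨h1, h2⟩, h3⟩ := h
  exact ⟨π, h1, h2, h3⟩

lemma le_mul_transportCost {μ ν : Measure X} {c a : ℝ≥0∞} (hc0 : c ≠ 0) (hc : c ≠ ⊤)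
    (h : ∀ π : Measure (X × X), π.map Prod.fst = μ → π.map Prod.snd = ν →
      a ≤ c * ∫⁻ z, edist z.1 z.2 ^ 2 ∂π) : a ≤ c * transportCost μ ν := by
  simp only [transportCost, ENNReal.mul_iInf_of_ne hc0 hc]
  exact le_iInf₂ fun π hπ => h π hπ.1 hπ.2

lemma Wp_two_eq (μ ν : Measure X) : Wp 2 μ ν = transportCost μ ν ^ (1 / 2 : ℝ) := by
  have := (ENNReal.orderIsoRpow (1 / 2 : ℝ) (by norm_num)).map_iInf₂
    (fun (π : Measure (X × X)) (_ : π ∈ {π : Measure (X × X) | π.map Prod.fst = μ ∧ π.map Prod.snd = ν}) =>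
      ∫⁻ z, edist z.1 z.2 ^ 2 ∂π)
  simp only [ENNReal.orderIsoRpow_apply] at this
  simp only [transportCost, this, Wp]
  norm_cast

lemma transportCost_self [OpensMeasurableSpace X] (μ : Measure X) : transportCost μ μ = 0 := by
  have hd : Measurable fun x : X => (x, x) := by fun_prop
  refine le_antisymm ((transportCost_le (μ.map fun x => (x, x)) ?_ ?_).trans ?_) zero_le
  · rw [Measure.map_map measurable_fst hd]; exact Measure.map_id
  · rw [Measure.map_map measurable_snd hd]; exact Measure.map_id
  · refine (lintegral_map_le _ _).trans ?_
    simp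

lemma transportCost_smul_le (c : ℝ≥0∞) (hc : c ≠ ⊤) (μ ν : Measure X) :
    transportCost (c • μ) (c • ν) ≤ c * transportCost μ ν := by
  rcases eq_or_ne c 0 with rfl | hc0
  · simp only [zero_smul, zero_mul]
    refine (transportCost_le 0 (by simp) (by simp)).trans (by simp)
  refine le_mul_transportCost hc0 hc fun π h1 h2 => ?_
  refine (transportCost_le (c • π) ?_ ?_).trans ?_
  · rw [Measure.map_smul, h1]
  · rw [Measure.map_smul, h2]
  · rw [lintegral_smul_measure, smul_eq_mul]

lemma transportCost_sum_le (μ ν : ℕ → Measure X) :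
    transportCost (Measure.sum μ) (Measure.sum ν) ≤ ∑' k, transportCost (μ k) (ν k) := by
  rcases eq_or_ne (∑' k, transportCost (μ k) (ν k)) ⊤ with h | h
  · rw [h]; exact le_top
  refine ENNReal.le_of_forall_pos_le_add fun ε hε _ => ?_
  obtain ⟨ε', hε', hsum⟩ := ENNReal.exists_pos_sum_of_countable (ε := (ε : ℝ≥0∞)) (by simpa using hε.ne') ℕ
  have hlt : ∀ k, transportCost (μ k) (ν k) < transportCost (μ k) (ν k) + ε' k := fun k =>
    ENNReal.lt_add_right (ENNReal.ne_top_of_tsum_ne_top h k) (by simpa using (hε' k).ne')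
  choose π h1 h2 h3 using fun k => exists_coupling_of_transportCost_lt (hlt k)
  refine (transportCost_le (Measure.sum π) ?_ ?_).trans ?_
  · rw [Measure.map_sum measurable_fst.aemeasurable]; simp_rw [h1]
  · rw [Measure.map_sum measurable_snd.aemeasurable]; simp_rw [h2]
  · rw [lintegral_sum_measure]
    calc _ ≤ ∑' k, (transportCost (μ k) (ν k) + ε' k) := ENNReal.tsum_le_tsum fun k => (h3 k).le
      _ = ∑' k, transportCost (μ k) (ν k) + ∑' k, (ε' k : ℝ≥0∞) := ENNReal.tsum_add
      _ ≤ _ := by gcongr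

lemma transportCost_add_left_le [OpensMeasurableSpace X] (μ ν γ : Measure X) :
    transportCost (γ + μ) (γ + ν) ≤ transportCost μ ν := by
  rw [← one_mul (transportCost μ ν)]
  refine le_mul_transportCost one_ne_zero one_ne_top fun π h1 h2 => ?_
  have hd : Measurable fun x : X => (x, x) := by fun_prop
  refine (transportCost_le (γ.map (fun x => (x, x)) + π) ?_ ?_).trans ?_
  · rw [Measure.map_add _ _ measurable_fst, h1, Measure.map_map measurable_fst hd]
    congr 1; exact Measure.map_id
  · rw [Measure.map_add _ _ measurable_snd, h2, Measure.map_map measurable_snd hd]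
    congr 1; exact Measure.map_id
  · rw [lintegral_add_measure, one_mul]
    have : ∫⁻ z, edist z.1 z.2 ^ 2 ∂(γ.map (fun x : X => (x, x))) ≤ 0 :=
      (lintegral_map_le _ _).trans (by simp)
    simpa using add_le_add_left this _

lemma transportCost_map_le [OpensMeasurableSpace X] [SecondCountableTopology X]
    [OpensMeasurableSpace Y] [SecondCountableTopology Y] [BorelSpace Y]
    {K : ℝ≥0} (hK : K ≠ 0) {f : X → Y}
    (hf : LipschitzWith K f) (μ ν : Measure X) :
    transportCost (μ.map f) (ν.map f) ≤ (K : ℝ≥0∞) ^ 2 * transportCost μ ν := by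
  have hfm : Measurable f := hf.continuous.measurable
  have hm : Measurable (Prod.map f f) := hfm.prodMap hfm
  refine le_mul_transportCost (by simpa using hK) (by simp) fun π h1 h2 => ?_
  refine (transportCost_le (π.map (Prod.map f f)) ?_ ?_).trans ?_
  · rw [Measure.map_map measurable_fst hm, ← h1, Measure.map_map hfm measurable_fst]; rfl
  · rw [Measure.map_map measurable_snd hm, ← h2, Measure.map_map hfm measurable_snd]; rfl
  · refine (lintegral_map_le _ _).trans ?_
    rw [← lintegral_const_mul' _ _ (by simp)]
    refine lintegral_mono fun z => ?_
    rw [← mul_pow]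
    exact pow_le_pow_left' (hf z.1 z.2) 2

lemma transportCost_map_self_le [OpensMeasurableSpace X] {f : X → X}
    (hf : Measurable f) (μ : Measure X) :
    transportCost (μ.map f) μ ≤ ∫⁻ x, edist (f x) x ^ 2 ∂μ := by
  have hm : Measurable fun x => (f x, x) := by fun_prop
  refine (transportCost_le (μ.map fun x => (f x, x)) ?_ ?_).trans (lintegral_map_le _ _)
  · rw [Measure.map_map measurable_fst hm]; rfl
  · rw [Measure.map_map measurable_snd hm]; exact Measure.map_id

lemma transportCost_le_of_bounded [OpensMeasurableSpace X] {μ ν : Measure X} [IsFiniteMeasure μ]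
    [IsFiniteMeasure ν] (huniv : μ univ = ν univ) {S : Set X} (hμ : ∀ᵐ x ∂μ, x ∈ S)
    (hν : ∀ᵐ x ∂ν, x ∈ S) {K : ℝ≥0∞} (hK : ∀ x ∈ S, ∀ y ∈ S, edist x y ≤ K) :
    transportCost μ ν ≤ K ^ 2 * μ univ := by
  rcases eq_or_ne (μ univ) 0 with h0 | h0
  · obtain rfl := Measure.measure_univ_eq_zero.1 h0
    obtain rfl := Measure.measure_univ_eq_zero.1 (huniv.symm.trans h0)
    exact (transportCost_le 0 (by simp) (by simp)).trans (by simp)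
  have hi : (μ univ)⁻¹ * μ univ = 1 := ENNReal.inv_mul_cancel h0 (measure_ne_top _ _)
  refine (transportCost_le ((μ univ)⁻¹ • μ.prod ν) ?_ ?_).trans ?_
  · rw [Measure.map_smul, Measure.map_fst_prod, smul_smul, ← huniv, hi, one_smul]
  · rw [Measure.map_smul, Measure.map_snd_prod, smul_smul, hi, one_smul]
  · rw [lintegral_smul_measure, smul_eq_mul]
    have : ∫⁻ z, edist z.1 z.2 ^ 2 ∂μ.prod ν ≤ ∫⁻ _, K ^ 2 ∂μ.prod ν := by
      refine lintegral_mono_ae ?_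
      filter_upwards [Measure.quasiMeasurePreserving_fst.ae hμ,
        Measure.quasiMeasurePreserving_snd.ae hν] with z h1 h2
      exact pow_le_pow_left' (hK _ h1 _ h2) 2
    rw [lintegral_const, ← univ_prod_univ, Measure.prod_prod, ← huniv] at this
    calc _ ≤ (μ univ)⁻¹ * (K ^ 2 * (μ univ * μ univ)) := by gcongr
      _ = K ^ 2 * μ univ * ((μ univ)⁻¹ * μ univ) := by ring
      _ = _ := by rw [hi, mul_one]

lemma transportCost_le_of_common_part [OpensMeasurableSpace X] {μ ν γ : Measure X}
    [IsFiniteMeasure μ] [IsFiniteMeasure ν] (huniv : μ univ = ν univ) (hγμ : γ ≤ μ) (hγν : γ ≤ ν)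
    {S : Set X} (hμ : ∀ᵐ x ∂μ, x ∈ S)
    (hν : ∀ᵐ x ∂ν, x ∈ S) {K : ℝ≥0∞} (hK : ∀ x ∈ S, ∀ y ∈ S, edist x y ≤ K) :
    transportCost μ ν ≤ K ^ 2 * (μ univ - γ univ) := by
  have : IsFiniteMeasure γ := isFiniteMeasure_of_le μ hγμ
  have e1 : μ = γ + (μ - γ) := by rw [add_comm, Measure.sub_add_cancel_of_le hγμ]
  have e2 : ν = γ + (ν - γ) := by rw [add_comm, Measure.sub_add_cancel_of_le hγν]
  have m1 : (μ - γ) univ = μ univ - γ univ := Measure.sub_apply .univ hγμ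
  have m2 : (ν - γ) univ = ν univ - γ univ := Measure.sub_apply .univ hγν
  calc transportCost μ ν = transportCost (γ + (μ - γ)) (γ + (ν - γ)) := by rw [← e1, ← e2]
    _ ≤ transportCost (μ - γ) (ν - γ) := transportCost_add_left_le _ _ _
    _ ≤ K ^ 2 * (μ - γ) univ := by
      refine transportCost_le_of_bounded (by rw [m1, m2, huniv]) ?_ ?_ hK
      · exact ae_mono Measure.sub_le hμ
      · exact ae_mono Measure.sub_le hν
    _ = _ := by rw [m1]

/-- Gluing couplings gives the triangle inequality, here in its squared form. -/
lemma transportCost_triangle [StandardBorelSpace X] [Nonempty X]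
    [OpensMeasurableSpace X] [SecondCountableTopology X] (α β γ : Measure X) [IsFiniteMeasure β] :
    transportCost α γ ≤ 2 * (transportCost α β + transportCost β γ) := by
  have key : ∀ π₁ π₂ : Measure (X × X), π₁.map Prod.fst = α → π₁.map Prod.snd = β →
      π₂.map Prod.fst = β → π₂.map Prod.snd = γ →
      transportCost α γ ≤ 2 * (∫⁻ z, edist z.1 z.2 ^ 2 ∂π₁ + ∫⁻ z, edist z.1 z.2 ^ 2 ∂π₂) := by
    intro π₁ π₂ h1 h2 h3 h4
    have : IsFiniteMeasure π₁ := by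
      constructor
      have := measure_lt_top β univ
      rwa [← h2, Measure.map_apply measurable_snd .univ, preimage_univ] at this
    have : IsFiniteMeasure π₂ := by
      constructor
      have := measure_lt_top β univ
      rwa [← h3, Measure.map_apply measurable_fst .univ, preimage_univ] at this
    set κ := π₂.condKernel.comap (Prod.snd : X × X → X) measurable_snd
    set η := π₁ ⊗ₘ κ
    have hη1 : η.map Prod.fst = π₁ := Measure.fst_compProd π₁ κ
    have hη2 : η.map (fun w => (w.1.2, w.2)) = π₂ := by
      have hm : Measurable fun w : (X × X) × X => (w.1.2, w.2) := by fun_prop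
      refine Measure.ext_of_lintegral _ fun f hf => ?_
      rw [lintegral_map hf hm, Measure.lintegral_compProd (by fun_prop)]
      simp only [κ, Kernel.comap_apply]
      conv_rhs => rw [← π₂.disintegrate π₂.condKernel, Measure.lintegral_compProd hf,
        Measure.fst, h3, ← h2]
      rw [lintegral_map _ measurable_snd]
      exact hf.lintegral_kernel_prod_right'
    have hm13 : Measurable fun w : (X × X) × X => (w.1.1, w.2) := by fun_prop
    refine (transportCost_le (η.map fun w => (w.1.1, w.2)) ?_ ?_).trans ?_
    · rw [Measure.map_map measurable_fst hm13, ← h1, ← hη1,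
        Measure.map_map measurable_fst measurable_fst]; rfl
    · rw [Measure.map_map measurable_snd hm13, ← h4, ← hη2,
        Measure.map_map measurable_snd (by fun_prop)]; rfl
    · have hd : Measurable fun z : X × X => edist z.1 z.2 ^ 2 := by fun_prop
      rw [lintegral_map hd hm13]
      calc ∫⁻ w, edist w.1.1 w.2 ^ 2 ∂η
          ≤ ∫⁻ w, 2 * (edist w.1.1 w.1.2 ^ 2 + edist w.1.2 w.2 ^ 2) ∂η := by
            refine lintegral_mono fun w => ?_
            refine (pow_le_pow_left' (edist_triangle w.1.1 w.1.2 w.2) 2).trans ?_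
            have := ENNReal.rpow_add_le_mul_rpow_add_rpow (edist w.1.1 w.1.2) (edist w.1.2 w.2)
              (p := 2) (by norm_num)
            norm_num at this
            exact this
        _ = _ := by
            rw [lintegral_const_mul _ (by fun_prop), lintegral_add_left (by fun_prop)]
            rw [← hη2, ← hη1, lintegral_map hd measurable_fst, lintegral_map hd (by fun_prop)]
  rcases eq_or_ne (transportCost α β + transportCost β γ) ⊤ with h | h
  · rw [h]; simp
  have hne := ENNReal.add_ne_top.1 h
  refine ENNReal.le_of_forall_pos_le_add fun ε hε _ => ?_
  have hε4 : (ε : ℝ≥0∞) / 4 ≠ 0 := by simp [hε.ne']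
  obtain ⟨π₁, h1, h2, h3⟩ :=
    exists_coupling_of_transportCost_lt (ENNReal.lt_add_right hne.1 hε4)
  obtain ⟨π₂, h4, h5, h6⟩ :=
    exists_coupling_of_transportCost_lt (ENNReal.lt_add_right hne.2 hε4)
  calc _ ≤ 2 * (transportCost α β + ε / 4 + (transportCost β γ + ε / 4)) :=
        (key π₁ π₂ h1 h2 h4 h5).trans (by gcongr)
    _ = 2 * (transportCost α β + transportCost β γ) + 4 * ((ε : ℝ≥0∞) / 4) := by ring
    _ = _ := by rw [ENNReal.mul_div_cancel (by norm_num) (by norm_num)]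

end TransportCost

lemma sq_lintegral_le {X : Type*} [MeasurableSpace X] (μ : Measure X) {f : X → ℝ≥0∞}
    (hf : AEMeasurable f μ) : (∫⁻ x, f x ∂μ) ^ 2 ≤ μ univ * ∫⁻ x, f x ^ 2 ∂μ := by
  have h := ENNReal.lintegral_mul_le_Lp_mul_Lq μ (p := 2) (q := 2) ⟨by norm_num, by norm_num, by norm_num⟩
    hf (g := fun _ => 1) aemeasurable_const
  have h2 := pow_le_pow_left' h 2
  have sq : ∀ a : ℝ≥0∞, (a ^ (1 / 2 : ℝ)) ^ 2 = a := fun a => by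
    rw [← ENNReal.rpow_natCast, ← ENNReal.rpow_mul]; norm_num
  rw [mul_pow, sq, sq] at h2
  simpa [mul_comm] using h2

lemma sq_integral_abs_le {X : Type*} [MeasurableSpace X] (μ : Measure X) {f : X → ℝ}
    (hf : AEStronglyMeasurable f μ) :
    ENNReal.ofReal ((∫ x, |f x| ∂μ) ^ 2) ≤ μ univ * ∫⁻ x, ENNReal.ofReal (f x ^ 2) ∂μ := by
  have h := sq_lintegral_le μ hf.aemeasurable.norm.ennreal_ofReal
  have e : ∀ x, ENNReal.ofReal ‖f x‖ ^ 2 = ENNReal.ofReal (f x ^ 2) := fun x => by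
    rw [← ENNReal.ofReal_pow (norm_nonneg _), Real.norm_eq_abs, sq_abs]
  simp_rw [e] at h
  refine le_trans ?_ h
  rw [ENNReal.ofReal_pow (integral_nonneg fun x => abs_nonneg _)]
  refine pow_le_pow_left' ?_ 2
  rw [integral_eq_lintegral_of_nonneg_ae (ae_of_all _ fun x => abs_nonneg _) (by fun_prop)]
  exact ENNReal.ofReal_toReal_le

lemma lintegral_withDensity_mul {X : Type*} [MeasurableSpace X] (μ : Measure X)
    {g f : X → ℝ≥0∞} (hg : Measurable g) (hf : Measurable f) :
    ∫⁻ x, f x ∂(μ.withDensity g) = ∫⁻ x, g x * f x ∂μ :=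
  lintegral_withDensity_eq_lintegral_mul _ hg hf

lemma map_withDensity_comp {X Y : Type*} [MeasurableSpace X] [MeasurableSpace Y] (μ : Measure X)
    {e : X → Y} (he : Measurable e) {g : Y → ℝ≥0∞} (hg : Measurable g) :
    (μ.withDensity fun x => g (e x)).map e = (μ.map e).withDensity g := by
  refine Measure.ext_of_lintegral _ fun f hf => ?_
  rw [lintegral_map hf he, lintegral_withDensity_mul _ (g := fun x => g (e x)) (f := fun x => f (e x))
    (hg.comp he) (hf.comp he),
    lintegral_withDensity_mul _ hg hf, lintegral_map (f := fun y => g y * f y) (hg.mul hf) he]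

/-- Lebesgue measure on the unit interval. -/
abbrev lebUnit : Measure ℝ := volume.restrict (Icc (0 : ℝ) 1)

instance : IsProbabilityMeasure lebUnit := ⟨by simp⟩

lemma lintegral_Icc_ofReal_eq {g : ℝ → ℝ} (hi : ∀ a b, IntervalIntegrable g volume a b)
    (h0 : ∀ t, 0 ≤ g t) {b : ℝ} (hb : 0 ≤ b) :
    ∫⁻ t in Icc 0 b, ENNReal.ofReal (g t) = ENNReal.ofReal (∫ t in (0 : ℝ)..b, g t) := by
  rw [intervalIntegral.integral_of_le hb, ← integral_Icc_eq_integral_Ioc,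
    ofReal_integral_eq_lintegral_ofReal _ (ae_of_all _ h0)]
  exact (integrableOn_Icc_iff_integrableOn_Ioc).2
    ((intervalIntegrable_iff_integrableOn_Ioc_of_le hb).1 (hi 0 b))

lemma map_primitive_eq {g : ℝ → ℝ} (hg : Measurable g) (hlow : ∀ t, 1 / 3 ≤ g t)
    (hup : ∀ t, g t ≤ 3) (h1 : ∫ t in (0 : ℝ)..1, g t = 1) :
    (lebUnit.withDensity fun t => ENNReal.ofReal (g t)).map (fun t => ∫ s in (0 : ℝ)..t, g s) = lebUnit := by
  have hi : ∀ a b, IntervalIntegrable g volume a b := fun a b =>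
    (intervalIntegrable_const (c := (3 : ℝ))).mono_fun hg.aestronglyMeasurable
      (ae_of_all _ fun t => by
        simp only [Real.norm_eq_abs]
        rw [abs_of_nonneg (by linarith [hlow t])]
        norm_num; exact hup t)
  set S : ℝ → ℝ := fun t => ∫ s in (0 : ℝ)..t, g s with hS
  have hdiff : ∀ a b, S b - S a = ∫ s in a..b, g s := fun a b =>
    intervalIntegral.integral_interval_sub_left (hi _ _) (hi _ _)
  have hgrow : ∀ a b, a ≤ b → (b - a) / 3 ≤ S b - S a := fun a b hab => by
    rw [hdiff]
    have := intervalIntegral.integral_mono_on hab intervalIntegrable_const (hi a b)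
      (fun x _ => hlow x)
    simp at this
    linarith
  have hmono : StrictMono S := fun a b hab => by linarith [hgrow a b hab.le]
  have hcont : Continuous S := intervalIntegral.continuous_primitive hi 0
  have hS0 : S 0 = 0 := intervalIntegral.integral_same
  have hsurj : ∀ a, ∃ c, S c = a := fun a => by
    have hs := hcont.surjective
      (Filter.tendsto_atTop_mono' _ (f₁ := fun t : ℝ => t / 3)
        (by filter_upwards [Filter.eventually_ge_atTop 0] with t ht
            have := hgrow 0 t ht; simp only [hS0] at this; simpa using this)
        (Filter.tendsto_id.atTop_div_const (by norm_num)))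
      (Filter.tendsto_atBot_mono' _ (f₁ := fun t : ℝ => t / 3)
        (by filter_upwards [Filter.eventually_le_atBot 0] with t ht
            have := hgrow t 0 ht; simp only [hS0] at this; linarith)
        (Filter.tendsto_id.atBot_div_const (by norm_num)))
    exact hs a
  have hg0 : ∀ t, 0 ≤ g t := fun t => by linarith [hlow t]
  have : IsFiniteMeasure (lebUnit.withDensity fun t => ENNReal.ofReal (g t)) := by
    refine isFiniteMeasure_withDensity ?_
    rw [lebUnit, lintegral_Icc_ofReal_eq hi hg0 zero_le_one]; simp
  refine Measure.ext_of_Iic _ _ fun a => ?_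
  obtain ⟨c, rfl⟩ := hsurj a
  have hpre : S ⁻¹' Iic (S c) = Iic c := by ext t; simp [hmono.le_iff_le]
  rw [Measure.map_apply hcont.measurable measurableSet_Iic, hpre,
    withDensity_apply _ measurableSet_Iic, Measure.restrict_restrict measurableSet_Iic,
    Measure.restrict_apply measurableSet_Iic]
  have hI : ∀ b : ℝ, Iic b ∩ Icc (0:ℝ) 1 = Icc 0 (min b 1) := fun b => by
    ext t; simp only [mem_inter_iff, mem_Iic, mem_Icc, le_min_iff]; tauto
  rw [hI, hI, Real.volume_Icc, sub_zero]
  rcases le_or_gt 0 c with hc | hc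
  · rw [lintegral_Icc_ofReal_eq hi hg0 (le_min hc zero_le_one)]
    congr 1
    exact hmono.monotone.map_min.trans (congrArg _ h1)
  · have hSc : S c < 0 := hS0 ▸ hmono hc
    rw [Icc_eq_empty (by simp [hc]), ENNReal.ofReal_of_nonpos ((min_le_left _ _).trans hSc.le)]
    simp

lemma transportCost_prod_le {X Y : Type*} [EMetricSpace X] [MeasurableSpace X]
    [OpensMeasurableSpace X] [EMetricSpace Y] [MeasurableSpace Y]
    [OpensMeasurableSpace Y] [SecondCountableTopology Y] [SecondCountableTopology X]
    (lam : Measure X) [IsProbabilityMeasure lam] (α β : Measure Y) [IsFiniteMeasure α] :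
    transportCost (lam.prod α) (lam.prod β) ≤ transportCost α β := by
  rw [← one_mul (transportCost α β)]
  refine le_mul_transportCost one_ne_zero one_ne_top fun π h1 h2 => ?_
  have : IsFiniteMeasure π := by
    constructor
    have := measure_lt_top α univ
    rwa [← h1, Measure.map_apply measurable_fst .univ, preimage_univ] at this
  have hm : Measurable fun w : X × (Y × Y) => ((w.1, w.2.1), (w.1, w.2.2)) := by fun_prop
  refine (transportCost_le ((lam.prod π).map fun w => ((w.1, w.2.1), (w.1, w.2.2))) ?_ ?_).trans ?_
  · rw [Measure.map_map measurable_fst hm, ← h1]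
    conv_rhs => rw [← Measure.map_id (μ := lam)]
    rw [Measure.map_prod_map _ _ measurable_id measurable_fst]; rfl
  · rw [Measure.map_map measurable_snd hm, ← h2]
    conv_rhs => rw [← Measure.map_id (μ := lam)]
    rw [Measure.map_prod_map _ _ measurable_id measurable_snd]; rfl
  · refine (lintegral_map_le _ _).trans ?_
    simp only [Prod.edist_eq, edist_self, one_mul]
    have := lintegral_prod_le (μ := lam) (ν := π) (fun w : X × (Y × Y) => max 0 (edist w.2.1 w.2.2) ^ 2)
    simpa using this

lemma setLIntegral_unit_sq_dev {g : ℝ → ℝ} (hg : Measurable g) (hb : ∀ t, |g t - 1| ≤ 1 / 2) :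
    1 / 2 ≤ ∫ s in (0 : ℝ)..1, g s ∧ ∫ s in (0 : ℝ)..1, g s ≤ 3 / 2 ∧
    ENNReal.ofReal (((∫ s in (0 : ℝ)..1, g s) - 1) ^ 2) ≤
      ∫⁻ s, ENNReal.ofReal ((g s - 1) ^ 2) ∂lebUnit ∧
    ∀ t ∈ Icc (0 : ℝ) 1, ENNReal.ofReal
      (((∫ s in (0 : ℝ)..t, g s / (∫ s in (0 : ℝ)..1, g s)) - t) ^ 2) ≤
      16 * ∫⁻ s, ENNReal.ofReal ((g s - 1) ^ 2) ∂lebUnit := by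
  have hlow : ∀ t, 1 / 2 ≤ g t := fun t => by linarith [(abs_le.1 (hb t)).1]
  have hup : ∀ t, g t ≤ 3 / 2 := fun t => by linarith [(abs_le.1 (hb t)).2]
  have hi : ∀ a b, IntervalIntegrable g volume a b := fun a b =>
    (intervalIntegrable_const (c := (3 : ℝ))).mono_fun hg.aestronglyMeasurable
      (ae_of_all _ fun t => by
        simp only [Real.norm_eq_abs]
        rw [abs_of_nonneg (by linarith [hlow t])]
        norm_num; linarith [hup t])
  set G := ∫ s in (0 : ℝ)..1, g s with hG
  have h1 : 1 / 2 ≤ G := by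
    have := intervalIntegral.integral_mono_on zero_le_one intervalIntegrable_const (hi 0 1)
      (fun x _ => hlow x)
    simpa using this
  have h2 : G ≤ 3 / 2 := by
    have := intervalIntegral.integral_mono_on zero_le_one (hi 0 1) intervalIntegrable_const
      (fun x _ => hup x)
    simpa using this
  have hI : ∀ a b, IntervalIntegrable (fun s => |g s - 1|) volume a b := fun a b =>
    ((hi a b).sub intervalIntegrable_const).abs
  set I := ∫ s in (0 : ℝ)..1, |g s - 1| with hIdef
  have hIcs : ENNReal.ofReal (I ^ 2) ≤ ∫⁻ s, ENNReal.ofReal ((g s - 1) ^ 2) ∂lebUnit := by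
    have := sq_integral_abs_le lebUnit (f := fun s => g s - 1) (by fun_prop)
    rw [measure_univ, one_mul] at this
    rwa [hIdef, intervalIntegral.integral_of_le zero_le_one, ← integral_Icc_eq_integral_Ioc]
  have hGI : |G - 1| ≤ I := by
    have e : G - 1 = ∫ s in (0 : ℝ)..1, (g s - 1) := by
      rw [intervalIntegral.integral_sub (hi 0 1) intervalIntegrable_const]; simp [hG]
    rw [e]
    exact intervalIntegral.abs_integral_le_integral_abs zero_le_one
  refine ⟨h1, h2, ?_, fun t ht => ?_⟩
  · refine le_trans (ENNReal.ofReal_le_ofReal ?_) hIcs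
    rw [← sq_abs]; gcongr
  have hpt : |(∫ s in (0 : ℝ)..t, g s / G) - t| ≤ 4 * I := by
    have e : (∫ s in (0 : ℝ)..t, g s / G) - t = ∫ s in (0 : ℝ)..t, (g s / G - 1) := by
      rw [intervalIntegral.integral_sub ((hi 0 t).div_const G) intervalIntegrable_const]; simp
    have hd : ∀ s, |g s / G - 1| ≤ 2 * (|g s - 1| + |G - 1|) := fun s => by
      have : g s / G - 1 = (g s - G) / G := by field_simp
      rw [this, abs_div, abs_of_pos (by linarith : 0 < G), div_le_iff₀ (by linarith)]
      have a1 : |g s - G| ≤ |g s - 1| + |G - 1| := by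
        rw [show g s - G = (g s - 1) - (G - 1) by ring]; exact abs_sub _ _
      nlinarith [abs_nonneg (g s - 1), abs_nonneg (G - 1)]
    have hid : ∀ a b, IntervalIntegrable (fun s => |g s / G - 1|) volume a b := fun a b =>
      (((hi a b).div_const G).sub intervalIntegrable_const).abs
    calc |(∫ s in (0 : ℝ)..t, g s / G) - t| = |∫ s in (0 : ℝ)..t, (g s / G - 1)| := by rw [e]
      _ ≤ ∫ s in (0 : ℝ)..t, |g s / G - 1| := intervalIntegral.abs_integral_le_integral_abs ht.1
      _ ≤ ∫ s in (0 : ℝ)..1, |g s / G - 1| :=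
        intervalIntegral.integral_mono_interval le_rfl ht.1 ht.2
          (ae_of_all _ fun s => abs_nonneg _) (hid 0 1)
      _ ≤ ∫ s in (0 : ℝ)..1, 2 * (|g s - 1| + |G - 1|) :=
        intervalIntegral.integral_mono_on zero_le_one (hid 0 1)
          (((hI 0 1).add intervalIntegrable_const).const_mul 2) fun s _ => hd s
      _ = 2 * (I + |G - 1|) := by
        rw [intervalIntegral.integral_const_mul,
          intervalIntegral.integral_add (hI 0 1) intervalIntegrable_const]; simp [hIdef]
      _ ≤ 4 * I := by linarith
  have : ((∫ s in (0 : ℝ)..t, g s / G) - t) ^ 2 ≤ 16 * I ^ 2 := by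
    rw [← sq_abs]
    calc _ ≤ (4 * I) ^ 2 := by gcongr
      _ = _ := by ring
  calc _ ≤ ENNReal.ofReal (16 * I ^ 2) := ENNReal.ofReal_le_ofReal this
    _ = 16 * ENNReal.ofReal (I ^ 2) := by rw [ENNReal.ofReal_mul (by norm_num)]; norm_num
    _ ≤ _ := by gcongr

/-- One step of the Knothe rearrangement: averaging a density along the first coordinate. -/
lemma transportCost_average_le {Y : Type*} [EMetricSpace Y] [MeasurableSpace Y]
    [OpensMeasurableSpace Y] [SecondCountableTopology Y] (ρ : Measure Y) [IsProbabilityMeasure ρ]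
    {g : ℝ × Y → ℝ} (hg : Measurable g) (hb : ∀ x, |g x - 1| ≤ 1 / 2) :
    transportCost
      ((lebUnit.prod ρ).withDensity fun x => ENNReal.ofReal (∫ s in (0 : ℝ)..1, g (s, x.2)))
      ((lebUnit.prod ρ).withDensity fun x => ENNReal.ofReal (g x)) ≤
      24 * ∫⁻ x, ENNReal.ofReal ((g x - 1) ^ 2) ∂(lebUnit.prod ρ) := by
  have hgy : ∀ y, Measurable fun s => g (s, y) := fun y => by fun_prop
  have hfib := fun y => setLIntegral_unit_sq_dev (hgy y) (fun t => hb (t, y))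
  set G : Y → ℝ := fun y => ∫ s in (0 : ℝ)..1, g (s, y) with hG
  have hGm : Measurable G := by
    have : G = fun y => ∫ s, g (s, y) ∂lebUnit := by
      funext y
      rw [hG]; simp only
      rw [intervalIntegral.integral_of_le zero_le_one, ← integral_Icc_eq_integral_Ioc]
    rw [this]
    exact (hg.stronglyMeasurable.integral_prod_left' (μ := lebUnit)).measurable
  have hlow : ∀ x, 1 / 2 ≤ g x := fun t => by linarith [(abs_le.1 (hb t)).1]
  have hup : ∀ x, g x ≤ 3 / 2 := fun t => by linarith [(abs_le.1 (hb t)).2]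
  have hq1 : ∀ t y, 1 / 3 ≤ g (t, y) / G y := fun t y => by
    rw [le_div_iff₀ (by linarith [(hfib y).1])]
    linarith [(hfib y).2.1, hlow (t, y)]
  have hq2 : ∀ t y, g (t, y) / G y ≤ 3 := fun t y => by
    rw [div_le_iff₀ (by linarith [(hfib y).1])]
    linarith [(hfib y).1, hup (t, y)]
  have hqi : ∀ y a b, IntervalIntegrable (fun s => g (s, y) / G y) volume a b := fun y a b =>
    (intervalIntegrable_const (c := (3 : ℝ))).mono_fun
      ((hgy y).div_const (G y)).aestronglyMeasurable
      (ae_of_all _ fun t => by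
        simp only [Real.norm_eq_abs]
        rw [abs_of_nonneg (by linarith [hq1 t y])]
        norm_num; exact hq2 t y)
  set S : ℝ × Y → ℝ := fun x => ∫ s in (0 : ℝ)..x.1, g (s, x.2) / G x.2 with hS
  have hSm : Measurable S := by
    have := measurable_uncurry_of_continuous_of_measurable
      (u := fun (t : ℝ) (y : Y) => ∫ s in (0 : ℝ)..t, g (s, y) / G y)
      (fun y => intervalIntegral.continuous_primitive (hqi y) 0) (fun t => by
        have hm : Measurable fun x : ℝ × Y => g x / G x.2 := by fun_prop
        simp only [intervalIntegral]
        exact ((hm.stronglyMeasurable.integral_prod_left'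
            (μ := volume.restrict (Ioc 0 t))).measurable).sub
          (hm.stronglyMeasurable.integral_prod_left'
            (μ := volume.restrict (Ioc t 0))).measurable)
    exact this
  have hmap : Measurable fun x : ℝ × Y => (S x, x.2) := by fun_prop
  have hpush : ((lebUnit.prod ρ).withDensity fun x => ENNReal.ofReal (g x)).map
      (fun x => (S x, x.2)) = (lebUnit.prod ρ).withDensity fun x => ENNReal.ofReal (G x.2) := by
    refine Measure.ext_of_lintegral _ fun f hf => ?_
    rw [lintegral_map hf hmap, lintegral_withDensity_mul _ (f := fun x => f (S x, x.2)) (by fun_prop)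
      (hf.comp hmap), lintegral_withDensity_mul _ (by fun_prop) hf,
      lintegral_prod_symm' _ (by fun_prop), lintegral_prod_symm' _ (by fun_prop)]
    refine lintegral_congr fun y => ?_
    have hfy : Measurable fun s => f (s, y) := by fun_prop
    change ∫⁻ t, ENNReal.ofReal (g (t, y)) * f (S (t, y), y) ∂lebUnit =
      ∫⁻ t, ENNReal.ofReal (G y) * f (t, y) ∂lebUnit
    rw [lintegral_const_mul _ hfy]
    have e := map_primitive_eq (g := fun s => g (s, y) / G y) (by fun_prop) (fun t => hq1 t y)
      (fun t => hq2 t y) (by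
        rw [intervalIntegral.integral_div]; exact div_self (by linarith [(hfib y).1]))
    conv_rhs => rw [← e]
    have hSy : Measurable fun t => S (t, y) := by fun_prop
    rw [lintegral_map hfy hSy, lintegral_withDensity_mul _ (f := fun t => f (S (t, y), y)) (by fun_prop)
      (hfy.comp hSy), ← lintegral_const_mul _ (by fun_prop)]
    refine lintegral_congr fun t => ?_
    rw [← mul_assoc, ← ENNReal.ofReal_mul (by linarith [(hfib y).1]),
      mul_div_cancel₀ _ (by linarith [(hfib y).1])]
  rw [← hpush]
  refine (transportCost_map_self_le hmap _).trans ?_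
  have hdm : Measurable fun x : ℝ × Y => ENNReal.ofReal ((S x - x.1) ^ 2) := by fun_prop
  have hed : ∀ x : ℝ × Y, edist (S x, x.2) x ^ 2 = ENNReal.ofReal ((S x - x.1) ^ 2) := fun x => by
    rw [Prod.edist_eq, edist_self, max_eq_left (by simp), edist_dist, Real.dist_eq,
      ← ENNReal.ofReal_pow (abs_nonneg _), sq_abs]
  simp_rw [hed]
  rw [lintegral_withDensity_mul _ (by fun_prop) hdm,
    lintegral_prod_symm' _ (by fun_prop), lintegral_prod_symm' _ (by fun_prop),
    ← lintegral_const_mul' _ _ (by norm_num)]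
  refine lintegral_mono fun y => ?_
  calc ∫⁻ t, ENNReal.ofReal (g (t, y)) * ENNReal.ofReal ((S (t, y) - t) ^ 2) ∂lebUnit
      ≤ ∫⁻ _, ENNReal.ofReal (3 / 2) * (16 * ∫⁻ s, ENNReal.ofReal ((g (s, y) - 1) ^ 2) ∂lebUnit)
          ∂lebUnit := by
        refine setLIntegral_mono' measurableSet_Icc fun t ht => ?_
        exact mul_le_mul' (ENNReal.ofReal_le_ofReal (hup _)) ((hfib y).2.2.2 t ht)
    _ = _ := by
        rw [lintegral_const, measure_univ, mul_one, ← mul_assoc]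
        congr 1
        rw [← ENNReal.ofReal_ofNat, ← ENNReal.ofReal_mul (by norm_num), ← ENNReal.ofReal_ofNat]
        norm_num

/-- Lebesgue measure on the unit cube. -/
abbrev lebCube (n : ℕ) : Measure (Fin n → ℝ) := Measure.pi fun _ => lebUnit

lemma transportCost_lebCube_le (n : ℕ) : ∃ C : ℝ≥0, ∀ g : (Fin n → ℝ) → ℝ, Measurable g →
    (∀ x, |g x - 1| ≤ 1 / 2) → ∫ x, g x ∂lebCube n = 1 →
    transportCost (lebCube n) ((lebCube n).withDensity fun x => ENNReal.ofReal (g x)) ≤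
      C * ∫⁻ x, ENNReal.ofReal ((g x - 1) ^ 2) ∂lebCube n := by
  induction n with
  | zero =>
    refine ⟨1, fun g hg _ h1 => ?_⟩
    have hconst : ∀ x, g x = 1 := fun x => by
      have : g = fun _ => g x := by funext y; rw [Subsingleton.elim y x]
      rw [this] at h1
      simpa using h1
    simp only [hconst, ENNReal.ofReal_one]
    have : (lebCube 0).withDensity (fun _ => 1) = lebCube 0 := withDensity_one
    rw [this, transportCost_self]
    exact zero_le
  | succ n ih =>
    obtain ⟨C, hC⟩ := ih
    refine ⟨2 * C + 48, fun g hg hb h1 => ?_⟩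
    set e := (MeasurableEquiv.piFinSuccAbove (fun _ : Fin (n + 1) => ℝ) 0).symm with he
    have hmp : MeasurePreserving e (lebUnit.prod (lebCube n)) (lebCube (n + 1)) :=
      (measurePreserving_piFinSuccAbove (fun _ : Fin (n + 1) => lebUnit) 0).symm _
    have hlip : LipschitzWith 1 e := by
      intro x y
      rw [ENNReal.coe_one, one_mul, edist_pi_le_iff]
      intro i
      refine Fin.cases ?_ (fun j => ?_) i
      · exact le_max_left _ _
      · exact (edist_le_pi_edist x.2 y.2 j).trans (le_max_right _ _)
    set g' : ℝ × (Fin n → ℝ) → ℝ := fun x => g (e x) with hg'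
    have hg'm : Measurable g' := hg.comp e.measurable
    have hfib := fun y => setLIntegral_unit_sq_dev (g := fun s => g' (s, y))
      (by fun_prop) (fun t => hb _)
    set G : (Fin n → ℝ) → ℝ := fun y => ∫ s in (0 : ℝ)..1, g' (s, y) with hG
    have hGe : G = fun y => ∫ s, g' (s, y) ∂lebUnit := by
      funext y
      rw [hG]; simp only
      rw [intervalIntegral.integral_of_le zero_le_one, ← integral_Icc_eq_integral_Ioc]
    have hGm : Measurable G := by
      rw [hGe]
      exact (hg'm.stronglyMeasurable.integral_prod_left' (μ := lebUnit)).measurable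
    have hcost : ∫⁻ x, ENNReal.ofReal ((g x - 1) ^ 2) ∂lebCube (n + 1) =
        ∫⁻ x, ENNReal.ofReal ((g' x - 1) ^ 2) ∂lebUnit.prod (lebCube n) :=
      (hmp.lintegral_comp (by fun_prop)).symm
    have hint : Integrable g' (lebUnit.prod (lebCube n)) :=
      Integrable.of_bound hg'm.aestronglyMeasurable 2 (ae_of_all _ fun x => by
        have := abs_le.1 (hb (e x))
        rw [Real.norm_eq_abs, abs_le]; constructor <;> simp only [hg'] <;> linarith)
    have hGint : ∫ y, G y ∂lebCube n = 1 := by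
      rw [← h1, ← hmp.integral_comp e.measurableEmbedding, hGe,
        integral_prod_symm _ hint]
    have hind := hC G hGm (fun y => abs_le.2 ⟨by linarith [(hfib y).1], by linarith [(hfib y).2.1]⟩)
      hGint
    have hprod : lebUnit.prod ((lebCube n).withDensity fun y => ENNReal.ofReal (G y)) =
        (lebUnit.prod (lebCube n)).withDensity fun x => ENNReal.ofReal (G x.2) :=
      prod_withDensity_right (by fun_prop)
    have hfin : IsFiniteMeasure ((lebUnit.prod (lebCube n)).withDensity
        fun x => ENNReal.ofReal (G x.2)) := by
      refine isFiniteMeasure_withDensity_ofReal ?_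
      refine (Integrable.of_bound (hGm.comp measurable_snd).aestronglyMeasurable 2
        (ae_of_all _ fun x => ?_)).2
      simp only [Function.comp]
      rw [Real.norm_eq_abs, abs_le]
      constructor <;> linarith [(hfib x.2).1, (hfib x.2).2.1]
    have hGdev : ∫⁻ y, ENNReal.ofReal ((G y - 1) ^ 2) ∂lebCube n ≤
        ∫⁻ x, ENNReal.ofReal ((g' x - 1) ^ 2) ∂lebUnit.prod (lebCube n) := by
      rw [lintegral_prod_symm' _ (by fun_prop)]
      exact lintegral_mono fun y => (hfib y).2.2.1
    have hm1 : (lebUnit.prod (lebCube n)).map e = lebCube (n + 1) := hmp.map_eq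
    have hm2 : ((lebUnit.prod (lebCube n)).withDensity fun x => ENNReal.ofReal (g' x)).map e =
        (lebCube (n + 1)).withDensity fun x => ENNReal.ofReal (g x) := by
      have := map_withDensity_comp (lebUnit.prod (lebCube n)) e.measurable
        (g := fun x => ENNReal.ofReal (g x)) (by fun_prop)
      rwa [hm1] at this
    rw [hcost, ← hm2]
    conv_lhs => rw [← hm1]
    refine (transportCost_map_le one_ne_zero hlip _ _).trans ?_
    rw [ENNReal.coe_one, one_pow, one_mul]
    refine (transportCost_triangle _ ((lebUnit.prod (lebCube n)).withDensity
        fun x => ENNReal.ofReal (G x.2)) _).trans ?_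
    have h3 := transportCost_average_le (lebCube n) hg'm (fun x => hb _)
    rw [← hprod] at h3 ⊢
    calc _ ≤ 2 * (C * ∫⁻ x, ENNReal.ofReal ((g' x - 1) ^ 2) ∂lebUnit.prod (lebCube n) +
        24 * ∫⁻ x, ENNReal.ofReal ((g' x - 1) ^ 2) ∂lebUnit.prod (lebCube n)) := by
          gcongr
          exact (transportCost_prod_le _ _ _).trans (hind.trans (by gcongr))
      _ = _ := by push_cast; ring

lemma measurableSet_cube {n : ℕ} (z : EuclideanSpace ℝ (Fin n)) (l : ℝ) :
    MeasurableSet (cube z l) := by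
  have : cube z l = ⋂ i, {x | x i ∈ Icc (z i) (z i + l)} := by ext; simp [cube]
  rw [this]
  exact MeasurableSet.iInter fun i => (by fun_prop : Measurable fun x : EuclideanSpace ℝ (Fin n) =>
    x i) measurableSet_Icc

/-- The affine parametrization of `cube z l` by the unit cube. -/
def cubeParam {n : ℕ} (z : EuclideanSpace ℝ (Fin n)) (l : ℝ) (x : Fin n → ℝ) :
    EuclideanSpace ℝ (Fin n) :=
  z + l • WithLp.toLp 2 x

lemma measurable_cubeParam {n : ℕ} (z : EuclideanSpace ℝ (Fin n)) (l : ℝ) :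
    Measurable (cubeParam z l) := by
  unfold cubeParam
  fun_prop

lemma map_cubeParam {n : ℕ} (z : EuclideanSpace ℝ (Fin n)) {l : ℝ} (hl : 0 < l) :
    volume.restrict (cube z l) = ENNReal.ofReal (l ^ n) • (lebCube n).map (cubeParam z l) := by
  have h1 : (volume : Measure (Fin n → ℝ)).map (cubeParam z l) =
      ENNReal.ofReal ((l ^ n)⁻¹) • volume := by
    have e : cubeParam z l = (fun x => z + x) ∘ (fun x => l • x) ∘ WithLp.toLp 2 := rfl
    rw [e, ← Measure.map_map (by fun_prop) (by fun_prop), ← Measure.map_map (by fun_prop)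
      (by fun_prop), (PiLp.volume_preserving_toLp (Fin n)).map_eq, Measure.map_addHaar_smul _ hl.ne',
      Measure.map_smul, map_add_left_eq_self, finrank_euclideanSpace_fin,
      abs_of_pos (by positivity)]
  have h2 : lebCube n = (volume : Measure (Fin n → ℝ)).restrict (cubeParam z l ⁻¹' cube z l) := by
    have : cubeParam z l ⁻¹' cube z l = univ.pi fun _ => Icc (0 : ℝ) 1 := by
      ext x
      simp only [cubeParam, cube, mem_preimage, mem_ofPred_eq, mem_pi, mem_univ, true_imp_iff,
        PiLp.add_apply, PiLp.smul_apply, smul_eq_mul, mem_Icc]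
      refine forall_congr' fun i => ?_
      constructor
      · rintro ⟨a, b⟩
        constructor <;> nlinarith
      · rintro ⟨a, b⟩
        constructor <;> nlinarith
    rw [this, volume_pi, Measure.restrict_pi_pi]
  rw [h2, ← Measure.restrict_map (measurable_cubeParam z l) (measurableSet_cube z l), h1,
    Measure.restrict_smul, smul_smul, ← ENNReal.ofReal_mul (by positivity),
    mul_inv_cancel₀ (by positivity), ENNReal.ofReal_one, one_smul]

lemma volume_cube {n : ℕ} (z : EuclideanSpace ℝ (Fin n)) {l : ℝ} (hl : 0 < l) :
    volume (cube z l) = ENNReal.ofReal (l ^ n) := by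
  have := congr_arg (fun m => m univ) (map_cubeParam z hl)
  simpa [Measure.map_apply (measurable_cubeParam z l)] using this

lemma exists_lipschitzWith_cubeParam (n : ℕ) : ∃ K : ℝ≥0, K ≠ 0 ∧
    ∀ (z : EuclideanSpace ℝ (Fin n)) (l : ℝ), 0 < l →
      LipschitzWith (l.toNNReal * K) (cubeParam z l) := by
  let T := (EuclideanSpace.equiv (Fin n) ℝ).symm.toContinuousLinearMap
  refine ⟨‖T‖₊ + 1, by positivity, fun z l hl => LipschitzWith.of_dist_le_mul fun x y => ?_⟩
  have : dist (cubeParam z l x) (cubeParam z l y) = l * ‖T (x - y)‖ := by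
    unfold cubeParam
    rw [dist_add_left, dist_smul₀, Real.norm_eq_abs, abs_of_pos hl, dist_eq_norm]
    rfl
  rw [this, NNReal.coe_mul, Real.coe_toNNReal _ hl.le, mul_assoc, dist_eq_norm]
  gcongr
  refine (T.le_opNorm _).trans ?_
  gcongr
  push_cast
  simp

lemma transportCost_cube_le (n : ℕ) : ∃ C : ℝ≥0, ∀ (z : EuclideanSpace ℝ (Fin n)) (l : ℝ), 0 < l →
    ∀ g : EuclideanSpace ℝ (Fin n) → ℝ, Measurable g → (∀ x, |g x - 1| ≤ 1 / 2) →
    ∫ x in cube z l, (g x - 1) = 0 →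
    transportCost (volume.restrict (cube z l))
        ((volume.restrict (cube z l)).withDensity fun x => ENNReal.ofReal (g x)) ≤
      C * ENNReal.ofReal (l ^ 2) * ∫⁻ x in cube z l, ENNReal.ofReal ((g x - 1) ^ 2) := by
  obtain ⟨C, hC⟩ := transportCost_lebCube_le n
  obtain ⟨K, hK, hlip⟩ := exists_lipschitzWith_cubeParam n
  refine ⟨K ^ 2 * C, fun z l hl g hg hb hint => ?_⟩
  have hA := measurable_cubeParam z l
  have hl0 : ENNReal.ofReal (l ^ n) ≠ 0 := by
    simp only [ne_eq, ENNReal.ofReal_eq_zero, not_le]; positivity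
  have hint' : ∫ x, g (cubeParam z l x) ∂lebCube n = 1 := by
    rw [map_cubeParam z hl, integral_smul_measure, integral_map hA.aemeasurable
      (by fun_prop), smul_eq_zero] at hint
    have h0 : (ENNReal.ofReal (l ^ n)).toReal ≠ 0 := by
      rw [ENNReal.toReal_ofReal (by positivity)]; positivity
    have := hint.resolve_left h0
    rw [integral_sub _ (integrable_const _)] at this
    · simpa [sub_eq_zero] using this
    · exact Integrable.of_bound (hg.comp hA).aestronglyMeasurable 2 (ae_of_all _ fun x => by
        have := abs_le.1 (hb (cubeParam z l x))
        rw [Real.norm_eq_abs, abs_le]; constructor <;> linarith)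
  have hmain := hC _ (hg.comp hA) (fun x => hb _) hint'
  rw [map_cubeParam z hl, withDensity_smul_measure, lintegral_smul_measure,
    lintegral_map (by fun_prop) hA]
  refine (transportCost_smul_le _ ENNReal.ofReal_ne_top _ _).trans ?_
  rw [← map_withDensity_comp (lebCube n) hA (g := fun x => ENNReal.ofReal (g x)) (by fun_prop)]
  have hstep := transportCost_map_le (mul_ne_zero (by simpa using hl) hK) (hlip z l hl) (lebCube n)
    ((lebCube n).withDensity fun x => ENNReal.ofReal (g (cubeParam z l x)))
  calc _ ≤ ENNReal.ofReal (l ^ n) * (((l.toNNReal * K : ℝ≥0) : ℝ≥0∞) ^ 2 *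
        (C * ∫⁻ x, ENNReal.ofReal ((g (cubeParam z l x) - 1) ^ 2) ∂lebCube n)) := by
        gcongr
        exact hstep.trans (by gcongr; exact hmain)
    _ = _ := by
        rw [smul_eq_mul, ENNReal.ofReal_pow hl.le 2]
        push_cast
        rw [ENNReal.ofNNReal_toNNReal]
        ring

lemma withDensity_eq_add_sum {X : Type*} [MeasurableSpace X] (lam : Measure X) {b : ℕ → ℝ}
    (hb0 : ∀ k, 0 ≤ b k) (hb : Summable b) {R : ℕ → Set X} (hR : ∀ k, MeasurableSet (R k))
    {γ F : X → ℝ} (hγ : Measurable γ) (hγ0 : ∀ x, 0 ≤ γ x) {g : ℕ → X → ℝ}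
    (hg : ∀ k, Measurable (g k)) (hg0 : ∀ k x, 0 ≤ g k x) (hg2 : ∀ k x, g k x ≤ 2)
    (hF : ∀ x, F x = γ x + ∑' k, (R k).indicator (fun x => b k * g k x) x) :
    lam.withDensity (fun x => ENNReal.ofReal (F x)) =
      lam.withDensity (fun x => ENNReal.ofReal (γ x)) +
        Measure.sum fun k => ENNReal.ofReal (b k) •
          (lam.restrict (R k)).withDensity fun x => ENNReal.ofReal (g k x) := by
  have h0 : ∀ k x, 0 ≤ (R k).indicator (fun x => b k * g k x) x := fun k x =>
    indicator_nonneg (fun x _ => mul_nonneg (hb0 k) (hg0 k x)) x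
  have hs : ∀ x, Summable fun k => (R k).indicator (fun x => b k * g k x) x := fun x =>
    Summable.of_nonneg_of_le (fun k => h0 k x) (fun k => by
      by_cases hx : x ∈ R k
      · rw [indicator_of_mem hx]
        exact mul_le_mul_of_nonneg_left (hg2 k x) (hb0 k)
      · rw [indicator_of_notMem hx]
        exact mul_nonneg (hb0 k) zero_le_two) (hb.mul_right 2)
  have e : (fun x => ENNReal.ofReal (F x)) = (fun x => ENNReal.ofReal (γ x)) +
      ∑' k, (R k).indicator (fun x => ENNReal.ofReal (b k) * ENNReal.ofReal (g k x)) := by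
    funext x
    rw [hF, ENNReal.ofReal_add (hγ0 x) (tsum_nonneg fun k => h0 k x),
      ENNReal.ofReal_tsum_of_nonneg (fun k => h0 k x) (hs x), Pi.add_apply, tsum_apply
        (Pi.summable.2 fun _ => ENNReal.summable)]
    congr 2
    funext k
    by_cases hx : x ∈ R k
    · simp only [indicator_of_mem hx]
      rw [ENNReal.ofReal_mul (hb0 k)]
    · simp only [indicator_of_notMem hx, ENNReal.ofReal_zero]
  have hm : ∀ k, Measurable
      ((R k).indicator fun x => ENNReal.ofReal (b k) * ENNReal.ofReal (g k x)) := fun k =>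
    Measurable.indicator (by fun_prop) (hR k)
  rw [e, withDensity_add_left (by fun_prop), withDensity_tsum hm]
  congr 2
  funext k
  rw [withDensity_indicator (hR k), ← withDensity_smul _ (hg k).ennreal_ofReal]
  rfl

lemma transportCost_perturbation_le {X : Type*} [EMetricSpace X] [MeasurableSpace X]
    [OpensMeasurableSpace X] (lam : Measure X)
    {a : ℕ → ℝ} (ha0 : ∀ k, 0 ≤ a k) (ha : Summable a) {R : ℕ → Set X}
    (hR : ∀ k, MeasurableSet (R k)) (hsub : ∀ k, R 0 ⊆ R k) (hpos : lam (R 0) ≠ 0)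
    (hfin : ∀ k, lam (R k) ≠ ⊤) {B : ℝ} (hB : ∀ k, lam.real (R k) ≤ B * lam.real (R 0))
    {K : ℝ≥0∞} (hP : ∀ k, ∀ g : X → ℝ, Measurable g → (∀ x, |g x - 1| ≤ 1 / 2) →
      ∫ x in R k, (g x - 1) ∂lam = 0 →
      transportCost (lam.restrict (R k))
        ((lam.restrict (R k)).withDensity fun x => ENNReal.ofReal (g x)) ≤
        K * ∫⁻ x in R k, ENNReal.ofReal ((g x - 1) ^ 2) ∂lam)
    {w F H : X → ℝ} (hw : ∀ x, w x = ∑' k, (R k).indicator (fun _ => a k) x)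
    (hF : Measurable F) (hH : Measurable H) {c δ : ℝ} (hc : 0 < c) (hδ : 0 ≤ δ)
    (hcδ : δ * (1 + B) ≤ c / 2) (hFw : ∀ x, c * w x ≤ F x) (hHw : ∀ x, |H x| ≤ δ * w x)
    (hint : ∫ x, H x ∂lam = 0) :
    transportCost (lam.withDensity fun x => ENNReal.ofReal (F x))
        (lam.withDensity fun x => ENNReal.ofReal (F x + H x)) ≤
      K * ENNReal.ofReal (2 * (1 + B) / c) * ∫⁻ x, ENNReal.ofReal (H x ^ 2 / w x) ∂lam := by
  have hind0 : ∀ k x, 0 ≤ (R k).indicator (fun _ => a k) x := fun k x =>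
    indicator_nonneg (fun _ _ => ha0 k) x
  have hws : ∀ x, Summable fun k => (R k).indicator (fun _ => a k) x := fun x =>
    Summable.of_nonneg_of_le (fun k => hind0 k x)
      (fun k => indicator_le_self' (fun _ _ => ha0 k) x) ha
  have hw0 : ∀ x, 0 ≤ w x := fun x => by rw [hw]; exact tsum_nonneg fun k => hind0 k x
  have hwm : Measurable w := by
    have : w = fun x => (∑' k, ENNReal.ofReal ((R k).indicator (fun _ => a k) x)).toReal := by
      funext x
      rw [← ENNReal.ofReal_tsum_of_nonneg (fun k => hind0 k x) (hws x), ENNReal.toReal_ofReal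
        (tsum_nonneg fun k => hind0 k x), hw]
    rw [this]
    exact (Measurable.tsum fun k =>
      (measurable_const.indicator (hR k)).ennreal_ofReal).ennreal_toReal
  have hR0 : 0 < lam.real (R 0) := ENNReal.toReal_pos hpos (hfin 0)
  set V := lam.real (R 0) with hV
  have hB1 : 1 ≤ B := by
    have := hB 0
    by_contra! h
    nlinarith
  set h : X → ℝ := fun x => H x / w x with hh
  have hhm : Measurable h := hH.div hwm
  have hwh : ∀ x, w x * h x = H x := fun x => by
    rcases eq_or_ne (w x) 0 with h0 | h0
    · have := hHw x
      rw [h0, mul_zero] at this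
      rw [h0, zero_mul, abs_nonpos_iff.1 this]
    · rw [hh]; field_simp
  have hhδ : ∀ x, |h x| ≤ δ := fun x => by
    rw [hh]; simp only
    rw [abs_div, abs_of_nonneg (hw0 x)]
    exact div_le_of_le_mul₀ (hw0 x) hδ (hHw x)
  have hfinM : ∀ k, IsFiniteMeasure (lam.restrict (R k)) := fun k =>
    ⟨by rw [Measure.restrict_apply_univ]; exact (hfin k).lt_top⟩
  have hhi : ∀ k, IntegrableOn h (R k) lam := fun k =>
    Integrable.of_bound hhm.aestronglyMeasurable δ (ae_of_all _ hhδ)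
  set A : ℕ → ℝ := fun k => ∫ x in R k, h x ∂lam with hA
  have hAabs : ∀ k, |A k| ≤ δ * (B * V) := fun k => by
    have := norm_setIntegral_le_of_norm_le_const (μ := lam) (s := R k) (f := h) (hfin k).lt_top
      (fun x _ => hhδ x)
    refine this.trans ?_
    gcongr
    exact hB k
  have hAsum : HasSum (fun k => a k * A k) 0 := by
    have e1 : ∀ k, ∫ x, (R k).indicator (fun x => a k * h x) x ∂lam = a k * A k := fun k => by
      rw [integral_indicator (hR k), integral_const_mul]
    have e2 : ∀ x, ∑' k, (R k).indicator (fun x => a k * h x) x = H x := fun x => by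
      rw [← hwh, hw, ← tsum_mul_right]
      congr 1
      funext k
      by_cases hx : x ∈ R k <;> simp [hx]
    have := hasSum_integral_of_summable_integral_norm (μ := lam)
      (F := fun k => (R k).indicator (fun x => a k * h x))
      (fun k => (integrable_indicator_iff (hR k)).2 ((hhi k).const_mul _)) (by
        refine Summable.of_nonneg_of_le (fun k => integral_nonneg fun x => norm_nonneg _)
          (fun k => ?_) (ha.mul_right (δ * (B * V)))
        have e3 : ∀ x, ‖(R k).indicator (fun x => a k * h x) x‖ =
            (R k).indicator (fun x => a k * |h x|) x := fun x => by
          by_cases hx : x ∈ R k <;> simp [hx, abs_of_nonneg (ha0 k)]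
        simp_rw [e3]
        rw [integral_indicator (hR k), integral_const_mul]
        refine mul_le_mul_of_nonneg_left ?_ (ha0 k)
        have := norm_setIntegral_le_of_norm_le_const (μ := lam) (s := R k) (f := fun x => |h x|)
          (hfin k).lt_top (fun x _ => by rw [Real.norm_eq_abs, abs_abs]; exact hhδ x)
        refine (le_abs_self _).trans (this.trans ?_)
        gcongr
        exact hB k)
    simp_rw [e1, e2, hint] at this
    exact this
  set g : ℕ → X → ℝ := fun k x => 1 + (h x - (R 0).indicator (fun _ => A k / V) x) / c with hg
  have hgm : ∀ k, Measurable (g k) := fun k => by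
    have : Measurable ((R 0).indicator fun _ : X => A k / V) := measurable_const.indicator (hR 0)
    fun_prop
  have hAV : ∀ k x, |(R 0).indicator (fun _ => A k / V) x| ≤ δ * B := fun k x => by
    by_cases hx : x ∈ R 0
    · rw [indicator_of_mem hx, abs_div, abs_of_pos hR0, div_le_iff₀ hR0]
      linarith [hAabs k]
    · rw [indicator_of_notMem hx, abs_zero]; positivity
  have hg1 : ∀ k x, |g k x - 1| ≤ 1 / 2 := fun k x => by
    rw [hg]; simp only
    rw [add_sub_cancel_left, abs_div, abs_of_pos hc, div_le_iff₀ hc]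
    calc _ ≤ |h x| + |(R 0).indicator (fun _ => A k / V) x| := abs_sub _ _
      _ ≤ δ + δ * B := add_le_add (hhδ x) (hAV k x)
      _ ≤ _ := by linarith
  have hgint : ∀ k, ∫ x in R k, (g k x - 1) ∂lam = 0 := fun k => by
    simp only [hg, add_sub_cancel_left]
    rw [integral_div, integral_sub (hhi k), setIntegral_indicator (hR 0),
      inter_eq_self_of_subset_right (hsub k), setIntegral_const, smul_eq_mul, ← hV,
      mul_div_cancel₀ _ hR0.ne', sub_self, zero_div]
    exact (integrable_const _).indicator (hR 0)
  have hcost : ∀ k, ∫⁻ x in R k, ENNReal.ofReal ((g k x - 1) ^ 2) ∂lam ≤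
      ENNReal.ofReal (2 * (1 + B) / c ^ 2) * ∫⁻ x in R k, ENNReal.ofReal (h x ^ 2) ∂lam :=
    fun k => by
    have hAsq : ENNReal.ofReal (A k ^ 2) ≤
        ENNReal.ofReal (B * V) * ∫⁻ x in R k, ENNReal.ofReal (h x ^ 2) ∂lam := by
      have h1 := sq_integral_abs_le (lam.restrict (R k)) (f := h) hhm.aestronglyMeasurable
      rw [Measure.restrict_apply_univ, ← ENNReal.ofReal_toReal (hfin k)] at h1
      refine le_trans (ENNReal.ofReal_le_ofReal ?_) (h1.trans ?_)
      · rw [← sq_abs]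
        exact pow_le_pow_left₀ (abs_nonneg _) abs_integral_le_integral_abs 2
      · gcongr
        exact hB k
    have hpt : ∀ x, ENNReal.ofReal ((g k x - 1) ^ 2) ≤ ENNReal.ofReal (2 / c ^ 2) *
        (ENNReal.ofReal (h x ^ 2) + (R 0).indicator (fun _ => ENNReal.ofReal ((A k / V) ^ 2)) x) :=
      fun x => by
      have e : (R 0).indicator (fun _ => ENNReal.ofReal ((A k / V) ^ 2)) x =
          ENNReal.ofReal ((R 0).indicator (fun _ => A k / V) x ^ 2) := by
        by_cases hx : x ∈ R 0 <;> simp [hx]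
      rw [e, ← ENNReal.ofReal_add (sq_nonneg _) (sq_nonneg _), ← ENNReal.ofReal_mul (by positivity)]
      refine ENNReal.ofReal_le_ofReal ?_
      simp only [hg, add_sub_cancel_left]
      rw [div_pow, div_mul_eq_mul_div]
      gcongr
      nlinarith [sq_nonneg (h x + (R 0).indicator (fun _ => A k / V) x)]
    calc _ ≤ ∫⁻ x in R k, ENNReal.ofReal (2 / c ^ 2) * (ENNReal.ofReal (h x ^ 2) +
          (R 0).indicator (fun _ => ENNReal.ofReal ((A k / V) ^ 2)) x) ∂lam :=
          lintegral_mono fun x => hpt x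
      _ = ENNReal.ofReal (2 / c ^ 2) * (∫⁻ x in R k, ENNReal.ofReal (h x ^ 2) ∂lam +
          ENNReal.ofReal ((A k / V) ^ 2) * ENNReal.ofReal V) := by
          rw [lintegral_const_mul' _ _ ENNReal.ofReal_ne_top, lintegral_add_left (by fun_prop),
            lintegral_indicator (hR 0), lintegral_const, Measure.restrict_apply_univ,
            Measure.restrict_apply (hR 0), inter_eq_self_of_subset_left (hsub k), hV,
            ofReal_measureReal (hfin 0)]
      _ = ENNReal.ofReal (2 / c ^ 2) * (∫⁻ x in R k, ENNReal.ofReal (h x ^ 2) ∂lam +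
          ENNReal.ofReal V⁻¹ * ENNReal.ofReal (A k ^ 2)) := by
          rw [← ENNReal.ofReal_mul (by positivity), ← ENNReal.ofReal_mul (by positivity)]
          have : (A k / V) ^ 2 * V = V⁻¹ * A k ^ 2 := by field_simp
          rw [this]
      _ ≤ ENNReal.ofReal (2 / c ^ 2) * (∫⁻ x in R k, ENNReal.ofReal (h x ^ 2) ∂lam +
          ENNReal.ofReal V⁻¹ * (ENNReal.ofReal (B * V) *
            ∫⁻ x in R k, ENNReal.ofReal (h x ^ 2) ∂lam)) := by gcongr
      _ = _ := by
          have e1 : ENNReal.ofReal (2 * (1 + B) / c ^ 2) =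
            ENNReal.ofReal (2 / c ^ 2) * (1 + ENNReal.ofReal V⁻¹ * ENNReal.ofReal (B * V)) := by
            rw [← ENNReal.ofReal_mul (by positivity), ← ENNReal.ofReal_one,
              ← ENNReal.ofReal_add (by positivity) (by positivity),
              ← ENNReal.ofReal_mul (by positivity)]
            congr 1
            field_simp
          rw [e1]
          ring
  have hgs : ∀ x, HasSum (fun k => (R k).indicator (fun x => c * a k * g k x) x)
      (c * w x + H x) := fun x => by
    have s1 : HasSum (fun k => (R k).indicator (fun _ => a k) x) (w x) := by
      rw [hw]; exact (hws x).hasSum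
    have s2 := ((s1.mul_left c).add (s1.mul_right (h x))).sub
      (hAsum.mul_right ((R 0).indicator (fun _ => 1 / V) x))
    rw [hwh, zero_mul, sub_zero] at s2
    refine s2.congr_fun fun k => ?_
    by_cases hx : x ∈ R k
    · by_cases hx0 : x ∈ R 0
      · simp only [hg, indicator_of_mem hx, indicator_of_mem hx0]
        field_simp
        ring
      · simp only [hg, indicator_of_mem hx, indicator_of_notMem hx0]
        field_simp
        ring
    · have hx0 : x ∉ R 0 := fun h => hx (hsub k h)
      simp [hx, hx0]
  have hbase := withDensity_eq_add_sum lam (b := fun k => c * a k) (R := R)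
    (γ := fun x => F x - c * w x) (F := F) (g := fun _ _ => 1)
    (fun k => mul_nonneg hc.le (ha0 k)) (ha.mul_left c) hR (by fun_prop)
    (fun x => sub_nonneg.2 (hFw x)) (fun k => measurable_const) (fun _ _ => zero_le_one)
    (fun _ _ => one_le_two) (fun x => by
      rw [hw, ← tsum_mul_left]
      have : ∀ k, (R k).indicator (fun _ => c * a k * 1) x =
        c * (R k).indicator (fun _ => a k) x := fun k => by by_cases hx : x ∈ R k <;> simp [hx]
      simp_rw [this]
      ring)
  have hpert := withDensity_eq_add_sum lam (b := fun k => c * a k) (R := R)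
    (γ := fun x => F x - c * w x) (F := fun x => F x + H x) (g := g)
    (fun k => mul_nonneg hc.le (ha0 k)) (ha.mul_left c) hR (by fun_prop)
    (fun x => sub_nonneg.2 (hFw x)) hgm
    (fun k x => by linarith [(abs_le.1 (hg1 k x)).1])
    (fun k x => by linarith [(abs_le.1 (hg1 k x)).2]) (fun x => by
      rw [(hgs x).tsum_eq]; ring)
  rw [hbase, hpert]
  refine (transportCost_add_left_le _ _ _).trans ((transportCost_sum_le _ _).trans ?_)
  have hsumh : ∑' k, ENNReal.ofReal (a k) * ∫⁻ x in R k, ENNReal.ofReal (h x ^ 2) ∂lam =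
      ∫⁻ x, ENNReal.ofReal (H x ^ 2 / w x) ∂lam := by
    have e1 : ∀ k, ENNReal.ofReal (a k) * ∫⁻ x in R k, ENNReal.ofReal (h x ^ 2) ∂lam =
        ∫⁻ x, ENNReal.ofReal ((R k).indicator (fun _ => a k) x) * ENNReal.ofReal (h x ^ 2) ∂lam :=
      fun k => by
      rw [← lintegral_const_mul' _ _ ENNReal.ofReal_ne_top, ← lintegral_indicator (hR k)]
      refine lintegral_congr fun x => ?_
      by_cases hx : x ∈ R k <;> simp [hx]
    simp_rw [e1]
    have hm : ∀ k, Measurable ((R k).indicator fun _ : X => a k) := fun k =>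
      measurable_const.indicator (hR k)
    rw [← lintegral_tsum fun k => by fun_prop]
    refine lintegral_congr fun x => ?_
    rw [ENNReal.tsum_mul_right, ← ENNReal.ofReal_tsum_of_nonneg (fun k => hind0 k x) (hws x), ← hw,
      ← ENNReal.ofReal_mul (hw0 x), sq, ← mul_assoc, hwh, hh, sq, mul_div_assoc]
  have hone : ∀ k, (lam.restrict (R k)).withDensity (fun _ => ENNReal.ofReal 1) =
      lam.restrict (R k) := fun k => by
    rw [ENNReal.ofReal_one]; exact withDensity_one
  calc _ ≤ ∑' k, ENNReal.ofReal (c * a k) * (K * (ENNReal.ofReal (2 * (1 + B) / c ^ 2) *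
        ∫⁻ x in R k, ENNReal.ofReal (h x ^ 2) ∂lam)) := by
        refine ENNReal.tsum_le_tsum fun k => ?_
        refine (transportCost_smul_le _ ENNReal.ofReal_ne_top _ _).trans ?_
        rw [hone]
        gcongr
        exact (hP k (g k) (hgm k) (hg1 k) (hgint k)).trans (by gcongr; exact hcost k)
    _ = ∑' k, K * ENNReal.ofReal (2 * (1 + B) / c) *
        (ENNReal.ofReal (a k) * ∫⁻ x in R k, ENNReal.ofReal (h x ^ 2) ∂lam) := by
        congr 1
        funext k
        have e1 : ENNReal.ofReal (2 * (1 + B) / c) =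
            ENNReal.ofReal c * ENNReal.ofReal (2 * (1 + B) / c ^ 2) := by
          rw [← ENNReal.ofReal_mul hc.le]
          congr 1
          field_simp
        rw [e1, ENNReal.ofReal_mul hc.le]
        ring
    _ = _ := by rw [ENNReal.tsum_mul_left, hsumh]

lemma tsum_dyadic_bounds {l D : ℝ} (hl : 0 < l) (hD : D ≤ l / 2) :
    4 / l ^ 2 * (max D 0) ^ 2 ≤ ∑' k : ℕ, (if l / 4 * (1 / 2) ^ k ≤ D then (1 / 4 : ℝ) ^ k else 0) ∧
    ∑' k : ℕ, (if l / 4 * (1 / 2) ^ k ≤ D then (1 / 4 : ℝ) ^ k else 0) ≤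
      64 / (3 * l ^ 2) * (max D 0) ^ 2 := by
  have hsq : ∀ k : ℕ, ((1 / 2 : ℝ) ^ k) ^ 2 = (1 / 4) ^ k := fun k => by
    rw [← pow_mul, mul_comm, pow_mul]; norm_num
  rcases le_or_gt D 0 with h0 | h0
  · have : ∀ k : ℕ, (if l / 4 * (1 / 2) ^ k ≤ D then (1 / 4 : ℝ) ^ k else 0) = 0 := fun k => by
      rw [if_neg]
      have : 0 < l / 4 * (1 / 2) ^ k := by positivity
      linarith
    simp_rw [this]
    simp [max_eq_right h0]
  rw [max_eq_left h0.le]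
  have hex : ∃ k : ℕ, l / 4 * (1 / 2) ^ k ≤ D := by
    obtain ⟨k, hk⟩ := exists_pow_lt_of_lt_one (show 0 < D / (l / 4) by positivity)
      (show (1 / 2 : ℝ) < 1 by norm_num)
    exact ⟨k, by rw [lt_div_iff₀ (by positivity)] at hk; linarith⟩
  classical
  set m := Nat.find hex with hm
  have hmD : l / 4 * (1 / 2) ^ m ≤ D := Nat.find_spec hex
  have hiff : ∀ k, l / 4 * (1 / 2) ^ k ≤ D ↔ m ≤ k := fun k => by
    refine ⟨fun h => Nat.find_min' hex h, fun h => le_trans ?_ hmD⟩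
    gcongr ?_ * ?_
    exact pow_le_pow_of_le_one (by norm_num) (by norm_num) h
  simp_rw [hiff]
  have hsum : Summable fun k : ℕ => if m ≤ k then (1 / 4 : ℝ) ^ k else 0 :=
    Summable.of_nonneg_of_le (fun k => by positivity) (fun k => by
      split_ifs
      · exact le_rfl
      · positivity) (summable_geometric_of_lt_one (r := 1 / 4) (by norm_num) (by norm_num))
  have hval : ∑' k : ℕ, (if m ≤ k then (1 / 4 : ℝ) ^ k else 0) = 4 / 3 * (1 / 4) ^ m := by
    rw [← hsum.sum_add_tsum_nat_add m, Finset.sum_eq_zero fun k hk => if_neg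
      (by simpa using Finset.mem_range.1 hk), zero_add]
    have : ∀ k, (if m ≤ k + m then (1 / 4 : ℝ) ^ (k + m) else 0) = (1 / 4) ^ k * (1 / 4) ^ m :=
      fun k => by rw [if_pos (by omega), pow_add]
    simp_rw [this]
    rw [tsum_mul_right, tsum_geometric_of_lt_one (by norm_num) (by norm_num)]
    norm_num
  rw [hval, ← hsq]
  set t : ℝ := (1 / 2) ^ m with ht
  have ht0 : 0 < t := by positivity
  constructor
  · have key : 2 * D / l ≤ t := by
      rcases Nat.eq_zero_or_pos m with h | h
      · rw [ht, h, pow_zero, div_le_one hl]; linarith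
      · have := (not_congr (hiff (m - 1))).2 (by omega)
        rw [not_le] at this
        have e : t = (1 / 2) ^ (m - 1) * (1 / 2) := by rw [ht, ← pow_succ]; congr 1; omega
        rw [div_le_iff₀ hl, e]
        nlinarith
    have e : 4 / l ^ 2 * D ^ 2 = (2 * D / l) ^ 2 := by field_simp; ring
    rw [e]
    have : (2 * D / l) ^ 2 ≤ t ^ 2 := by gcongr
    nlinarith [sq_nonneg t]
  · have key : t ≤ 4 * D / l := by rw [le_div_iff₀ hl]; linarith
    calc 4 / 3 * t ^ 2 ≤ 4 / 3 * (4 * D / l) ^ 2 := by gcongr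
      _ = _ := by field_simp; ring

lemma le_bdist_iff {n : ℕ} [NeZero n] {z : EuclideanSpace ℝ (Fin n)} {l r : ℝ}
    {x : EuclideanSpace ℝ (Fin n)} :
    r ≤ bdist z l x ↔ ∀ i, r ≤ x i - z i ∧ r ≤ z i + l - x i := by
  unfold bdist
  rw [le_ciInf_iff (Set.finite_range _).bddBelow]
  simp

lemma mem_cube_iff {n : ℕ} [NeZero n] {z : EuclideanSpace ℝ (Fin n)} {l : ℝ}
    {x : EuclideanSpace ℝ (Fin n)} : x ∈ cube z l ↔ 0 ≤ bdist z l x := by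
  rw [le_bdist_iff]
  refine forall_congr' fun i => ?_
  simp only [mem_Icc]
  constructor <;> rintro ⟨h1, h2⟩ <;> constructor <;> linarith

lemma bdist_le {n : ℕ} [NeZero n] (z : EuclideanSpace ℝ (Fin n)) (l : ℝ)
    (x : EuclideanSpace ℝ (Fin n)) : bdist z l x ≤ l / 2 := by
  have := (le_bdist_iff.1 (le_refl (bdist z l x))) 0
  linarith [this.1, this.2]

/-- The distance to the complement of `cube z l`. -/
def innerDist {n : ℕ} (z : EuclideanSpace ℝ (Fin n)) (l : ℝ) (x : EuclideanSpace ℝ (Fin n)) : ℝ :=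
  max (bdist z l x) 0

lemma innerDist_nonneg {n : ℕ} (z : EuclideanSpace ℝ (Fin n)) (l : ℝ)
    (x : EuclideanSpace ℝ (Fin n)) : 0 ≤ innerDist z l x := le_max_right _ _

lemma cube_inset_eq {n : ℕ} [NeZero n] (z : EuclideanSpace ℝ (Fin n)) (l r : ℝ) :
    cube (z + WithLp.toLp 2 fun _ => r) (l - 2 * r) = {x | r ≤ bdist z l x} := by
  ext x
  rw [mem_ofPred_eq, le_bdist_iff]
  refine forall_congr' fun i => ?_
  simp only [mem_Icc, PiLp.add_apply]
  constructor <;> rintro ⟨h1, h2⟩ <;> constructor <;> linarith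

lemma transportCost_cube_perturbation_le (n : ℕ) [NeZero n] : ∃ C : ℝ≥0, ∃ η : ℝ, 0 < η ∧
    ∀ (z : EuclideanSpace ℝ (Fin n)) (l : ℝ), 0 < l →
    ∀ F H : EuclideanSpace ℝ (Fin n) → ℝ, Measurable F → Measurable H → ∀ c δ : ℝ, 0 < c → 0 ≤ δ →
      δ ≤ η * c → (∀ x, c * innerDist z l x ^ 2 ≤ F x) →
      (∀ x, |H x| ≤ δ * innerDist z l x ^ 2) → ∫ x, H x = 0 →
      transportCost (volume.withDensity fun x => ENNReal.ofReal (F x))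
        (volume.withDensity fun x => ENNReal.ofReal (F x + H x)) ≤
      C * ENNReal.ofReal (l ^ 2 / c) * ∫⁻ x, ENNReal.ofReal (H x ^ 2 / innerDist z l x ^ 2) := by
  obtain ⟨C, hC⟩ := transportCost_cube_le n
  set B : ℝ := 2 ^ n with hBdef
  have hB0 : 0 < B := by positivity
  refine ⟨C * (32 / 3 * (1 + B)).toNNReal, 3 / (2 * 64 / 4 * (1 + B)), by positivity,
    fun z l hl F H hF hH c δ hc hδ hη hFc hHδ hint => ?_⟩
  set r : ℕ → ℝ := fun k => l / 4 * (1 / 2) ^ k with hr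
  have hr0 : ∀ k, 0 < r k := fun k => by positivity
  have hr1 : ∀ k, r k ≤ l / 4 := fun k => by
    have : (1 / 2 : ℝ) ^ k ≤ 1 := pow_le_one₀ (by norm_num) (by norm_num)
    rw [hr]; simp only
    nlinarith
  set R : ℕ → Set (EuclideanSpace ℝ (Fin n)) := fun k =>
    cube (z + WithLp.toLp 2 fun _ => r k) (l - 2 * r k) with hR
  have hRmem : ∀ k x, x ∈ R k ↔ r k ≤ bdist z l x := fun k x => by
    rw [hR]; simp only
    rw [cube_inset_eq, mem_ofPred_eq]
  have hvol : ∀ k, volume (R k) = ENNReal.ofReal ((l - 2 * r k) ^ n) := fun k =>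
    volume_cube _ (by linarith [hr1 k])
  set w : EuclideanSpace ℝ (Fin n) → ℝ := fun x => ∑' k, (R k).indicator (fun _ => (1 / 4 : ℝ) ^ k) x
    with hw
  have hwb : ∀ x, 4 / l ^ 2 * innerDist z l x ^ 2 ≤ w x ∧
      w x ≤ 64 / (3 * l ^ 2) * innerDist z l x ^ 2 := fun x => by
    have := tsum_dyadic_bounds hl (bdist_le z l x)
    have e : w x = ∑' k : ℕ, (if l / 4 * (1 / 2) ^ k ≤ bdist z l x then (1 / 4 : ℝ) ^ k else 0) :=
      tsum_congr fun k => by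
        by_cases hx : x ∈ R k
        · rw [indicator_of_mem hx, if_pos ((hRmem k x).1 hx)]
        · rw [indicator_of_notMem hx, if_neg (fun h => hx ((hRmem k x).2 h))]
    rw [e]
    exact this
  have hvr : ∀ k, volume.real (R k) = (l - 2 * r k) ^ n := fun k => by
    rw [measureReal_def, hvol, ENNReal.toReal_ofReal]
    have := hr1 k
    exact pow_nonneg (by linarith) _
  have hmain := transportCost_perturbation_le (volume : Measure (EuclideanSpace ℝ (Fin n)))
    (a := fun k => (1 / 4 : ℝ) ^ k) (R := R) (B := B) (K := C * ENNReal.ofReal (l ^ 2))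
    (w := w) (F := F) (H := H) (c := c * (3 * l ^ 2 / 64)) (δ := δ * (l ^ 2 / 4))
    (fun k => by positivity) (summable_geometric_of_lt_one (by norm_num) (by norm_num))
    (fun k => measurableSet_cube _ _) (fun k x hx => (hRmem k x).2
      (le_trans (by simpa [hr] using hr1 k) ((hRmem 0 x).1 hx)))
    (by
      rw [hvol, ne_eq, ENNReal.ofReal_eq_zero, not_le]
      have := hr1 0
      exact pow_pos (by linarith) _)
    (fun k => by rw [hvol]; exact ENNReal.ofReal_ne_top) (fun k => by
      rw [hvr, hvr, hBdef, ← mul_pow]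
      have h0 : r 0 = l / 4 := by simp [hr]
      have := hr1 k
      have := hr0 k
      exact pow_le_pow_left₀ (by linarith) (by rw [h0]; linarith) _)
    (fun k g hg hb hi => (hC _ _ (by linarith [hr1 k]) g hg hb hi).trans (by
      have := hr1 k
      have := hr0 k
      gcongr <;> linarith))
    (fun x => rfl) hF hH (by positivity) (by positivity) (by
      rw [div_mul_eq_mul_div, le_div_iff₀ (by positivity)] at hη
      nlinarith [sq_nonneg l, mul_le_mul_of_nonneg_right hη (sq_nonneg l)])
    (fun x => le_trans (by
      calc c * (3 * l ^ 2 / 64) * w x ≤ c * (3 * l ^ 2 / 64) *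
            (64 / (3 * l ^ 2) * innerDist z l x ^ 2) := by gcongr; exact (hwb x).2
        _ = c * innerDist z l x ^ 2 := by field_simp) (hFc x))
    (fun x => (hHδ x).trans (by
      calc δ * innerDist z l x ^ 2 = δ * (l ^ 2 / 4) * (4 / l ^ 2 * innerDist z l x ^ 2) := by
            field_simp
        _ ≤ _ := by gcongr; exact (hwb x).1)) hint
  refine hmain.trans ?_
  have hpt : ∀ x, ENNReal.ofReal (H x ^ 2 / w x) ≤
      ENNReal.ofReal (l ^ 2 / 4) * ENNReal.ofReal (H x ^ 2 / innerDist z l x ^ 2) := fun x => by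
    rw [← ENNReal.ofReal_mul (by positivity)]
    refine ENNReal.ofReal_le_ofReal ?_
    rcases eq_or_lt_of_le (innerDist_nonneg z l x) with h | h
    · have := hHδ x
      rw [← h, zero_pow two_ne_zero, mul_zero, abs_nonpos_iff] at this
      simp [this]
    · calc H x ^ 2 / w x ≤ H x ^ 2 / (4 / l ^ 2 * innerDist z l x ^ 2) := by
            gcongr; exact (hwb x).1
        _ = _ := by field_simp
  calc _ ≤ C * ENNReal.ofReal (l ^ 2) * ENNReal.ofReal (2 * (1 + B) / (c * (3 * l ^ 2 / 64))) *
        ∫⁻ x, ENNReal.ofReal (l ^ 2 / 4) * ENNReal.ofReal (H x ^ 2 / innerDist z l x ^ 2) := by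
        gcongr with x; exact hpt x
    _ = _ := by
        rw [lintegral_const_mul' _ _ ENNReal.ofReal_ne_top]
        have e : ENNReal.ofReal (l ^ 2) * ENNReal.ofReal (2 * (1 + B) / (c * (3 * l ^ 2 / 64))) *
            ENNReal.ofReal (l ^ 2 / 4) =
            ENNReal.ofReal (32 / 3 * (1 + B)) * ENNReal.ofReal (l ^ 2 / c) := by
          rw [← ENNReal.ofReal_mul (by positivity), ← ENNReal.ofReal_mul (by positivity),
            ← ENNReal.ofReal_mul (by positivity)]
          congr 1
          field_simp
          ring
        rw [ENNReal.coe_mul, ENNReal.ofNNReal_toNNReal, mul_assoc (C : ℝ≥0∞) (ENNReal.ofReal (32 / 3 * (1 + B))), ← e]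
        ring

lemma LipschitzWith.abs_sub_le_of_norm_fderiv_le {E : Type*} [NormedAddCommGroup E]
    [NormedSpace ℝ E] [FiniteDimensional ℝ E] {f : E → ℝ} {K : ℝ≥0} (hf : LipschitzWith K f)
    {x y : E} {r M : ℝ} (hr : dist y x < r)
    (hM : ∀ p ∈ ball x r, DifferentiableAt ℝ f p → ‖fderiv ℝ f p‖ ≤ M) :
    |f y - f x| ≤ M * dist y x := by
  borelize E
  let vol : Measure E := Measure.addHaar
  set v := y - x with hv
  have hdv : dist y x = ‖v‖ := dist_eq_norm y x
  have hdiff : ∀ᵐ p ∂vol, ∀ᵐ t : ℝ, DifferentiableAt ℝ f (p + t • v) := by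
    have hm : MeasurableSet {q : E × ℝ | DifferentiableAt ℝ f (q.1 + q.2 • v)} :=
      (by fun_prop : Measurable fun q : E × ℝ => q.1 + q.2 • v)
        (measurableSet_of_differentiableAt ℝ f)
    rw [Measure.ae_ae_comm hm]
    refine ae_of_all _ fun t => ?_
    exact (measurePreserving_add_right vol (t • v)).quasiMeasurePreserving.ae
      (hf.ae_differentiableAt (μ := vol))
  have hgood : ∀ᵐ p ∂vol, p ∈ ball x (r - ‖v‖) → |f (p + v) - f p| ≤ M * ‖v‖ := by
    filter_upwards [hdiff] with p hp hpx
    have hlip : LipschitzWith (K * ‖v‖₊) fun t : ℝ => f (p + t • v) := by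
      refine hf.comp (LipschitzWith.of_dist_le_mul fun s t => ?_)
      rw [dist_add_left, dist_eq_norm, ← sub_smul, norm_smul, coe_nnnorm, mul_comm, Real.dist_eq,
        Real.norm_eq_abs]
    have hftc := (hlip.lipschitzOnWith (s := uIcc 0 1)).absolutelyContinuousOnInterval
      |>.integral_deriv_eq_sub
    simp only [one_smul, zero_smul, add_zero] at hftc
    rw [← hftc, ← Real.norm_eq_abs]
    have := intervalIntegral.norm_integral_le_of_norm_le_const_ae (a := 0) (b := 1)
      (f := deriv fun t : ℝ => f (p + t • v)) (C := M * ‖v‖) (by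
        filter_upwards [hp] with t ht htI
        rw [uIoc_of_le zero_le_one] at htI
        have hd : HasDerivAt (fun t : ℝ => f (p + t • v)) (fderiv ℝ f (p + t • v) v) t := by
          have h1 : HasDerivAt (fun t : ℝ => p + t • v) v t := by
            simpa using ((hasDerivAt_id t).smul_const v).const_add p
          exact ht.hasFDerivAt.comp_hasDerivAt t h1
        rw [hd.deriv]
        refine (ContinuousLinearMap.le_opNorm _ _).trans ?_
        gcongr
        refine hM _ ?_ ht
        rw [mem_ball, dist_eq_norm] at hpx ⊢
        calc ‖p + t • v - x‖ = ‖(p - x) + t • v‖ := by congr 1; abel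
          _ ≤ ‖p - x‖ + ‖t • v‖ := norm_add_le _ _
          _ ≤ ‖p - x‖ + ‖v‖ := by
            gcongr
            rw [norm_smul, Real.norm_eq_abs, abs_of_pos htI.1]
            nlinarith [norm_nonneg v, htI.2]
          _ < r := by linarith)
    simpa using this
  have hclosed : IsClosed {p | |f (p + v) - f p| ≤ M * ‖v‖} :=
    isClosed_le (by have := hf.continuous; fun_prop) continuous_const
  have hx : x ∈ ball x (r - ‖v‖) := mem_ball_self (by linarith)
  have hsub : ball x (r - ‖v‖) ⊆ {p | |f (p + v) - f p| ≤ M * ‖v‖} := by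
    intro p hp
    by_contra hcon
    have hopen : IsOpen (ball x (r - ‖v‖) ∩ {p | |f (p + v) - f p| ≤ M * ‖v‖}ᶜ) :=
      isOpen_ball.inter hclosed.isOpen_compl
    refine (hopen.measure_pos vol ⟨p, hp, hcon⟩).ne' ?_
    refine measure_mono_null (fun q hq => ?_) hgood
    intro h
    exact hq.2 (h hq.1)
  have := hsub hx
  rw [mem_ofPred_eq, hv, add_sub_cancel] at this
  rw [hdv]
  exact this

lemma bdist_le_add_dist {n : ℕ} [NeZero n] (z : EuclideanSpace ℝ (Fin n)) (l : ℝ)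
    (x y : EuclideanSpace ℝ (Fin n)) : bdist z l y ≤ bdist z l x + dist x y := by
  rw [← sub_le_iff_le_add, le_bdist_iff]
  intro i
  have h := le_bdist_iff.1 (le_refl (bdist z l y)) i
  have h2 : |x i - y i| ≤ dist x y := by
    rw [dist_eq_norm]
    exact PiLp.norm_apply_le (x - y) i
  have h3 := abs_le.1 h2
  constructor <;> linarith [h.1, h.2, h3.1, h3.2]

lemma innerDist_le_add_dist {n : ℕ} [NeZero n] (z : EuclideanSpace ℝ (Fin n)) (l : ℝ)
    (x y : EuclideanSpace ℝ (Fin n)) : innerDist z l y ≤ innerDist z l x + dist x y := by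
  unfold innerDist
  refine max_le ?_ (add_nonneg (le_max_right _ _) dist_nonneg)
  exact (bdist_le_add_dist z l x y).trans (by gcongr; exact le_max_left _ _)

lemma continuous_innerDist {n : ℕ} [NeZero n] (z : EuclideanSpace ℝ (Fin n)) (l : ℝ) :
    Continuous (innerDist z l) := by
  refine LipschitzWith.continuous (K := 1) (LipschitzWith.of_dist_le_mul fun x y => ?_)
  rw [NNReal.coe_one, one_mul, Real.dist_eq, abs_le]
  constructor <;> linarith [innerDist_le_add_dist z l x y, innerDist_le_add_dist z l y x, dist_comm x y]

lemma isClosed_cube {n : ℕ} (z : EuclideanSpace ℝ (Fin n)) (l : ℝ) : IsClosed (cube z l) := by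
  have : cube z l = ⋂ i, {x | x i ∈ Icc (z i) (z i + l)} := by ext; simp [cube]
  rw [this]
  exact isClosed_iInter fun i => isClosed_Icc.preimage
    (by fun_prop : Continuous fun x : EuclideanSpace ℝ (Fin n) => x i)

lemma innerDist_of_mem {n : ℕ} [NeZero n] {z : EuclideanSpace ℝ (Fin n)} {l : ℝ}
    {x : EuclideanSpace ℝ (Fin n)} (hx : x ∈ cube z l) : innerDist z l x = bdist z l x :=
  max_eq_left (mem_cube_iff.1 hx)

lemma innerDist_of_notMem {n : ℕ} [NeZero n] {z : EuclideanSpace ℝ (Fin n)} {l : ℝ}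
    {x : EuclideanSpace ℝ (Fin n)} (hx : x ∉ cube z l) : innerDist z l x = 0 :=
  max_eq_right (by rw [mem_cube_iff, not_le] at hx; exact hx.le)

lemma memG.bounds {n : ℕ} [NeZero n] {c₂ : ℝ} {z : EuclideanSpace ℝ (Fin n)} {l : ℝ}
    {φ : EuclideanSpace ℝ (Fin n) → ℝ} (h : memG c₂ z l φ) (x : EuclideanSpace ℝ (Fin n)) :
    (c₂ * l ^ 2)⁻¹ * innerDist z l x ^ 2 ≤ φ x ∧ φ x ≤ c₂ / l ^ 2 * innerDist z l x ^ 2 := by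
  by_cases hx : x ∈ cube z l
  · rw [innerDist_of_mem hx]
    obtain ⟨h1, h2⟩ := h.2.2.2.1 x hx
    constructor
    · refine le_trans (le_of_eq ?_) h1
      rw [mul_inv]; ring
    · refine h2.trans (le_of_eq ?_)
      ring
  · rw [innerDist_of_notMem hx, h.2.2.1 x hx]
    simp

lemma memG.abs_sub_le {n : ℕ} [NeZero n] {c₂ : ℝ} (hc₂ : 0 < c₂) {z : EuclideanSpace ℝ (Fin n)}
    {l : ℝ} {φ : EuclideanSpace ℝ (Fin n) → ℝ} (h : memG c₂ z l φ)
    (x y : EuclideanSpace ℝ (Fin n)) :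
    |φ y - φ x| ≤ c₂ / l ^ 2 * (innerDist z l x + 2 * dist x y) * dist x y := by
  rcases eq_or_ne x y with rfl | hxy
  · simp
  have hd : 0 < dist y x := dist_pos.2 hxy.symm
  obtain ⟨K, hK⟩ := h.1
  rw [dist_comm x y]
  refine hK.abs_sub_le_of_norm_fderiv_le (r := 2 * dist y x) (by linarith) fun p hp hdp => ?_
  have hpx : innerDist z l p ≤ innerDist z l x + 2 * dist y x := by
    have := innerDist_le_add_dist z l x p
    rw [mem_ball, dist_comm] at hp
    linarith
  by_cases hpc : p ∈ cube z l
  · refine (h.2.2.2.2.1 p hpc hdp).trans ?_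
    rw [← innerDist_of_mem hpc, mul_div_right_comm]
    gcongr
  · have : φ =ᶠ[nhds p] fun _ => 0 := by
      filter_upwards [(isClosed_cube z l).isOpen_compl.mem_nhds hpc] with q hq
      exact h.2.2.1 q hq
    rw [this.fderiv_eq]
    have := innerDist_nonneg z l x
    simp only [fderiv_fun_const, Pi.zero_apply, norm_zero]
    positivity

lemma exists_measurable_density_of_bounds {X : Type*} [MeasurableSpace X] {μ lam : Measure X}
    [IsFiniteMeasure μ] [IsFiniteMeasure lam] {f : X → ℝ} {a b : ℝ} (hab : a ≤ b)
    (hμ : μ = lam.withDensity fun y => ENNReal.ofReal (f y))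
    (hf : ∀ᵐ y ∂lam, a ≤ f y ∧ f y ≤ b) :
    ∃ g : X → ℝ, Measurable g ∧ (∀ x, a ≤ g x ∧ g x ≤ b) ∧
      μ = lam.withDensity fun y => ENNReal.ofReal (g y) := by
  have hlow : lam.withDensity (fun _ => ENNReal.ofReal a) ≤ μ := by
    rw [hμ]
    exact withDensity_mono (hf.mono fun y hy => ENNReal.ofReal_le_ofReal hy.1)
  have hup : μ ≤ lam.withDensity (fun _ => ENNReal.ofReal b) := by
    rw [hμ]
    exact withDensity_mono (hf.mono fun y hy => ENNReal.ofReal_le_ofReal hy.2)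
  have hac : μ ≪ lam := by
    rw [hμ]
    exact withDensity_absolutelyContinuous _ _
  have hr := Measure.withDensity_rnDeriv_eq μ lam hac
  have hrm : Measurable (μ.rnDeriv lam) := Measure.measurable_rnDeriv μ lam
  have hrlow : (fun _ => ENNReal.ofReal a) ≤ᵐ[lam] μ.rnDeriv lam := by
    refine ae_le_of_forall_setLIntegral_le_of_sigmaFinite measurable_const fun s hs _ => ?_
    rw [← withDensity_apply _ hs, ← withDensity_apply _ hs, hr]
    exact hlow s
  have hrup : μ.rnDeriv lam ≤ᵐ[lam] fun _ => ENNReal.ofReal b := by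
    refine ae_le_of_forall_setLIntegral_le_of_sigmaFinite hrm fun s hs _ => ?_
    rw [← withDensity_apply _ hs, ← withDensity_apply _ hs, hr]
    exact hup s
  refine ⟨fun x => max a (min b (μ.rnDeriv lam x).toReal), by fun_prop,
    fun x => ⟨le_max_left _ _, max_le hab (min_le_left _ _)⟩, ?_⟩
  refine hr.symm.trans (withDensity_congr_ae ?_)
  filter_upwards [hrlow, hrup] with x h1 h2
  have hfin : μ.rnDeriv lam x ≠ ⊤ := ne_top_of_le_ne_top ENNReal.ofReal_ne_top h2
  have hb : 0 ≤ b ∨ b < 0 := le_or_gt 0 b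
  rcases hb with hb | hb
  · have h3 : (μ.rnDeriv lam x).toReal ≤ b := by
      rw [← ENNReal.toReal_ofReal hb]
      exact ENNReal.toReal_mono ENNReal.ofReal_ne_top h2
    rw [min_eq_right h3, ENNReal.ofReal_max, ENNReal.ofReal_toReal hfin]
    exact (max_eq_right h1).symm
  · rw [ENNReal.ofReal_of_nonpos hb.le, nonpos_iff_eq_zero] at h2
    rw [h2, ENNReal.ofReal_of_nonpos]
    refine max_le (by linarith) ((min_le_left _ _).trans hb.le)

/-- Averaging a function on a product over the second variable, conditionally on the first. -/
lemma exists_fiber_average {X : Type*} [MeasurableSpace X] [StandardBorelSpace X] [Nonempty X]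
    (π : Measure (X × X)) [IsFiniteMeasure π] {q : X × X → ℝ} (hq : Measurable q)
    (hq01 : ∀ z, q z ∈ Icc (0 : ℝ) 1) :
    ∃ p : X → ℝ, Measurable p ∧ (∀ x, p x ∈ Icc (0 : ℝ) 1) ∧
      (π.withDensity fun z => ENNReal.ofReal (q z)).map Prod.fst =
        (π.map Prod.fst).withDensity (fun x => ENNReal.ofReal (p x)) ∧
      (∀ x t s, (∀ y, |q (x, y) - t| ≤ s) → |p x - t| ≤ s) ∧
      ∀ (f : X → ℝ) (W : X → ℝ≥0∞), Measurable f → Measurable W →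
        ∫⁻ x, ENNReal.ofReal ((p x - f x) ^ 2) * W x ∂(π.map Prod.fst) ≤
          ∫⁻ z, ENNReal.ofReal ((q z - f z.1) ^ 2) * W z.1 ∂π := by
  have hqx : ∀ x, Measurable fun y => q (x, y) := fun x => hq.comp measurable_prodMk_left
  have hint : ∀ x, Integrable (fun y => q (x, y)) (π.condKernel x) := fun x =>
    Integrable.of_bound (hqx x).aestronglyMeasurable 1 (ae_of_all _ fun y => by
      rw [Real.norm_eq_abs, abs_of_nonneg (hq01 _).1]; exact (hq01 _).2)
  have hpm : Measurable fun x => ∫ y, q (x, y) ∂(π.condKernel x) :=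
    (MeasureTheory.StronglyMeasurable.integral_kernel_prod_right' (κ := π.condKernel) hq.stronglyMeasurable).measurable
  have hdev : ∀ x t s, (∀ y, |q (x, y) - t| ≤ s) →
      |∫ y, q (x, y) ∂(π.condKernel x) - t| ≤ s := by
    intro x t s h
    have := norm_integral_le_of_norm_le_const (μ := π.condKernel x) (f := fun y => q (x, y) - t)
      (ae_of_all _ h)
    rwa [integral_sub (hint x) (integrable_const t), integral_const, probReal_univ, one_smul,
      mul_one] at this
  refine ⟨fun x => ∫ y, q (x, y) ∂(π.condKernel x), hpm, ?_, ?_, hdev, ?_⟩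
  · intro x
    have := abs_le.1 (hdev x (1 / 2) (1 / 2) fun y => abs_le.2
      ⟨by linarith [(hq01 (x, y)).1], by linarith [(hq01 (x, y)).2]⟩)
    constructor <;> linarith
  · ext s hs
    rw [Measure.map_apply measurable_fst hs, withDensity_apply _ (measurable_fst hs),
      withDensity_apply _ hs, ← lintegral_indicator (measurable_fst hs), ← lintegral_indicator hs,
      ← Measure.lintegral_condKernel (ρ := π) (Measurable.indicator (by fun_prop) (measurable_fst hs))]
    refine lintegral_congr fun x => ?_
    by_cases hx : x ∈ s
    · simp only [indicator, hx, mem_preimage, if_true]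
      rw [ofReal_integral_eq_lintegral_ofReal (hint x) (ae_of_all _ fun y => (hq01 _).1)]
    · simp [indicator, hx]
  · intro f W hf hW
    rw [← Measure.lintegral_condKernel (ρ := π) (by fun_prop)]
    refine lintegral_mono fun x => ?_
    dsimp only
    rw [lintegral_mul_const _ (by fun_prop)]
    gcongr
    have h1 := sq_integral_abs_le (π.condKernel x) (f := fun y => q (x, y) - f x)
      ((hqx x).sub_const _).aestronglyMeasurable
    rw [measure_univ, one_mul] at h1
    refine le_trans (ENNReal.ofReal_le_ofReal ?_) h1
    rw [← sq_abs]
    gcongr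
    have h2 := abs_integral_le_integral_abs (μ := π.condKernel x) (f := fun y => q (x, y) - f x)
    rwa [integral_sub (hint x) (integrable_const _), integral_const, probReal_univ, one_smul] at h2

lemma sq_lintegral_mul_le {X : Type*} [MeasurableSpace X] (μ : Measure X) {f g : X → ℝ≥0∞}
    (hf : AEMeasurable f μ) (hg : AEMeasurable g μ) :
    (∫⁻ x, f x * g x ∂μ) ^ 2 ≤ (∫⁻ x, f x ^ 2 ∂μ) * ∫⁻ x, g x ^ 2 ∂μ := by
  have h := ENNReal.lintegral_mul_le_Lp_mul_Lq μ Real.HolderConjugate.two_two hf hg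
  refine (pow_le_pow_left' h 2).trans (le_of_eq ?_)
  rw [mul_pow, ← ENNReal.rpow_natCast, ← ENNReal.rpow_natCast, ← ENNReal.rpow_mul,
    ← ENNReal.rpow_mul]
  norm_num

section Localization

variable {X : Type*} [MeasurableSpace X] {μ lam : Measure X} {R : Set X} {g : X → ℝ}

lemma withDensity_eq_of_restrict_eq (hR : MeasurableSet R) (hg : Measurable g)
    (hμ : μ.restrict R = (lam.restrict R).withDensity fun y => ENNReal.ofReal (g y))
    {F : X → ℝ} (hF : Measurable F) (hF0 : ∀ x, 0 ≤ F x) (hFR : ∀ x ∉ R, F x = 0) :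
    μ.withDensity (fun x => ENNReal.ofReal (F x)) =
      lam.withDensity fun x => ENNReal.ofReal (F x * g x) := by
  have h1 : (fun x => ENNReal.ofReal (F x)) = R.indicator fun x => ENNReal.ofReal (F x) := by
    ext x
    by_cases hx : x ∈ R <;> simp [hx, hFR]
  have h2 : (fun x => ENNReal.ofReal (F x * g x)) =
      R.indicator ((fun x => ENNReal.ofReal (g x)) * fun x => ENNReal.ofReal (F x)) := by
    ext x
    by_cases hx : x ∈ R
    · simp only [hx, indicator_of_mem, Pi.mul_apply]
      rw [mul_comm (F x), ENNReal.ofReal_mul' (hF0 x)]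
    · simp [hx, hFR]
  rw [h1, withDensity_indicator hR, hμ, h2, withDensity_indicator hR,
    withDensity_mul _ (by fun_prop) (by fun_prop)]

lemma lintegral_eq_of_restrict_eq (hR : MeasurableSet R) (hg : Measurable g)
    (hμ : μ.restrict R = (lam.restrict R).withDensity fun y => ENNReal.ofReal (g y))
    {F : X → ℝ} (hF : Measurable F) (hF0 : ∀ x, 0 ≤ F x) (hFR : ∀ x ∉ R, F x = 0) :
    ∫⁻ x, ENNReal.ofReal (F x) ∂μ = ∫⁻ x, ENNReal.ofReal (F x * g x) ∂lam := by
  rw [← setLIntegral_univ, ← withDensity_apply _ MeasurableSet.univ,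
    withDensity_eq_of_restrict_eq hR hg hμ hF hF0 hFR, withDensity_apply _ MeasurableSet.univ,
    setLIntegral_univ]

lemma integral_eq_of_restrict_eq (hg : Measurable g) (hg0 : ∀ x, 0 ≤ g x)
    (hμ : μ.restrict R = (lam.restrict R).withDensity fun y => ENNReal.ofReal (g y))
    {F : X → ℝ} (hFR : ∀ x ∉ R, F x = 0) :
    ∫ x, F x ∂μ = ∫ x, F x * g x ∂lam := by
  rw [← setIntegral_eq_integral_of_forall_compl_eq_zero hFR, hμ,
    integral_withDensity_eq_integral_toReal_smul (by fun_prop)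
      (ae_of_all _ fun x => ENNReal.ofReal_lt_top),
    ← setIntegral_eq_integral_of_forall_compl_eq_zero (μ := lam) (s := R)
      (f := fun x => F x * g x) (fun x hx => by simp [hFR x hx])]
  refine integral_congr_ae (ae_of_all _ fun x => ?_)
  simp [ENNReal.toReal_ofReal (hg0 x), mul_comm]

end Localization

/-- Comparison of the normalising constant of a perturbed weight with the weighted variance of the
perturbation. -/
lemma sq_integral_sub_le {X : Type*} [MeasurableSpace X] {μ : Measure X} [IsFiniteMeasure μ]
    {φ p D : X → ℝ} (hφ : Measurable φ) (hp : Measurable p) (hD : Measurable D)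
    (hD0 : ∀ x, 0 ≤ D x) (hφ01 : ∀ x, φ x ∈ Icc (0 : ℝ) 1) (hp01 : ∀ x, p x ∈ Icc (0 : ℝ) 1)
    {A : ℝ} (hA : 0 ≤ A) (hDφ : ∀ x, D x ^ 2 ≤ A * φ x) (hz : ∀ x, D x = 0 → p x = φ x) :
    ENNReal.ofReal ((∫ x, p x ∂μ - ∫ x, φ x ∂μ) ^ 2) ≤
      ENNReal.ofReal (A * ∫ x, φ x ∂μ) * ∫⁻ x, ENNReal.ofReal ((p x - φ x) ^ 2 / D x ^ 2) ∂μ := by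
  have hφi : Integrable φ μ := Integrable.of_bound hφ.aestronglyMeasurable 1
    (ae_of_all _ fun y => by rw [Real.norm_eq_abs, abs_of_nonneg (hφ01 _).1]; exact (hφ01 _).2)
  have hpi : Integrable p μ := Integrable.of_bound hp.aestronglyMeasurable 1
    (ae_of_all _ fun y => by rw [Real.norm_eq_abs, abs_of_nonneg (hp01 _).1]; exact (hp01 _).2)
  rw [← integral_sub hpi hφi, ← sq_abs, ← Real.norm_eq_abs, ENNReal.ofReal_pow (norm_nonneg _),
    ofReal_norm]
  have h1 : ∫⁻ x, ‖p x - φ x‖ₑ ∂μ =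
      ∫⁻ x, ENNReal.ofReal (D x) * ENNReal.ofReal (|p x - φ x| / D x) ∂μ := by
    refine lintegral_congr fun x => ?_
    rw [← ENNReal.ofReal_mul (hD0 x), ← ofReal_norm, Real.norm_eq_abs]
    by_cases hx : D x = 0
    · simp [hz x hx, hx]
    · rw [mul_div_cancel₀ _ hx]
  calc ‖∫ x, p x - φ x ∂μ‖ₑ ^ 2 ≤ (∫⁻ x, ‖p x - φ x‖ₑ ∂μ) ^ 2 := by
        gcongr; exact enorm_integral_le_lintegral_enorm _
    _ ≤ _ := by
        rw [h1]
        refine (sq_lintegral_mul_le μ (by fun_prop) (by fun_prop)).trans ?_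
        gcongr ?_ * ?_
        · rw [← integral_const_mul, ofReal_integral_eq_lintegral_ofReal (hφi.const_mul A)
            (ae_of_all _ fun x => mul_nonneg hA (hφ01 x).1)]
          refine lintegral_mono fun x => ?_
          rw [← ENNReal.ofReal_pow (hD0 x)]
          exact ENNReal.ofReal_le_ofReal (hDφ x)
        · refine lintegral_mono fun x => ?_
          rw [← ENNReal.ofReal_pow (div_nonneg (abs_nonneg _) (hD0 x)), div_pow, sq_abs]

lemma transportCost_reweight_le (n : ℕ) [NeZero n] {c₂ c₄ : ℝ} (hc₂ : 0 < c₂) (hc₄ : 0 < c₄) :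
    ∃ C : ℝ≥0, ∃ η : ℝ, 0 < η ∧ η * c₂ ≤ 1 / 2 ∧
      ∀ (μ : Measure (EuclideanSpace ℝ (Fin n))) [IsFiniteMeasure μ]
        (z : EuclideanSpace ℝ (Fin n)) (l : ℝ), 0 < l →
      ∀ g : EuclideanSpace ℝ (Fin n) → ℝ, Measurable g → (∀ x, c₄⁻¹ ≤ g x ∧ g x ≤ c₄) →
        μ.restrict (cube z l) =
          (volume.restrict (cube z l)).withDensity (fun y => ENNReal.ofReal (g y)) →
      ∀ φ p : EuclideanSpace ℝ (Fin n) → ℝ, Measurable φ → Measurable p →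
        (∀ x, φ x ∈ Icc (0 : ℝ) 1) → (∀ x, p x ∈ Icc (0 : ℝ) 1) →
        (∀ x, (c₂ * l ^ 2)⁻¹ * innerDist z l x ^ 2 ≤ φ x ∧
          φ x ≤ c₂ / l ^ 2 * innerDist z l x ^ 2) →
        (∀ x, |p x - φ x| ≤ η / l ^ 2 * innerDist z l x ^ 2) →
        0 < ∫ x, φ x ∂μ →
        transportCost (μ.withDensity fun x => ENNReal.ofReal (φ x))
          (μ.withDensity fun x => ENNReal.ofReal ((∫ x, φ x ∂μ) / (∫ x, p x ∂μ) * p x)) ≤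
        C * ENNReal.ofReal (l ^ 4) *
          ∫⁻ x, ENNReal.ofReal ((p x - φ x) ^ 2 / innerDist z l x ^ 2) ∂μ := by
  obtain ⟨C, η, hη, hC⟩ := transportCost_cube_perturbation_le n
  refine ⟨C * (c₂ * c₄).toNNReal * (c₄ * (8 + 8 * c₂ ^ 2)).toNNReal,
    min (1 / (2 * c₂)) (η / (2 * (1 + c₂ ^ 2) * c₂ * c₄ ^ 2)), by positivity, ?_, ?_⟩
  · calc _ ≤ 1 / (2 * c₂) * c₂ := by gcongr; exact min_le_left _ _
      _ = 1 / 2 := by field_simp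
  intro μ _ z l hl g hg hgb hμ φ p hφ hp hφ01 hp01 hφb hpφ hM
  set τ := min (1 / (2 * c₂)) (η / (2 * (1 + c₂ ^ 2) * c₂ * c₄ ^ 2)) with hτ
  have hτ0 : 0 < τ := by positivity
  have hτ1 : τ * c₂ ≤ 1 / 2 := by
    calc _ ≤ 1 / (2 * c₂) * c₂ := by gcongr; exact min_le_left _ _
      _ = 1 / 2 := by field_simp
  have hτ2 : τ * (2 * (1 + c₂ ^ 2) * c₂ * c₄ ^ 2) ≤ η := by
    rw [← le_div_iff₀ (by positivity)]
    exact min_le_right _ _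
  set D := innerDist z l with hDdef
  have hDm : Measurable D := (continuous_innerDist z l).measurable
  have hD0 : ∀ x, 0 ≤ D x := innerDist_nonneg z l
  have hDR : ∀ x ∉ cube z l, D x = 0 := fun x hx => innerDist_of_notMem hx
  have hφz : ∀ x, D x = 0 → φ x = 0 := fun x hx =>
    le_antisymm (by simpa [hx] using (hφb x).2) (hφ01 x).1
  have hz : ∀ x, D x = 0 → p x = φ x := fun x hx => by
    have := hpφ x
    rw [hx] at this
    simpa [sub_eq_zero] using this
  have hDφ : ∀ x, D x ^ 2 ≤ c₂ * l ^ 2 * φ x := fun x => by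
    have := (hφb x).1
    rwa [inv_mul_le_iff₀ (by positivity)] at this
  have hpφ' : ∀ x, |p x - φ x| ≤ τ * c₂ * φ x := fun x =>
    calc |p x - φ x| ≤ τ / l ^ 2 * D x ^ 2 := hpφ x
      _ ≤ τ / l ^ 2 * (c₂ * l ^ 2 * φ x) := by gcongr; exact hDφ x
      _ = τ * c₂ * φ x := by field_simp
  have hφi : Integrable φ μ := Integrable.of_bound hφ.aestronglyMeasurable 1
    (ae_of_all _ fun y => by rw [Real.norm_eq_abs, abs_of_nonneg (hφ01 _).1]; exact (hφ01 _).2)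
  have hpi : Integrable p μ := Integrable.of_bound hp.aestronglyMeasurable 1
    (ae_of_all _ fun y => by rw [Real.norm_eq_abs, abs_of_nonneg (hp01 _).1]; exact (hp01 _).2)
  set M := ∫ x, φ x ∂μ with hMdef
  set N := ∫ x, p x ∂μ with hNdef
  have hNM : |N - M| ≤ τ * c₂ * M := by
    rw [hMdef, hNdef, ← integral_sub hpi hφi, ← integral_const_mul]
    exact abs_integral_le_integral_abs.trans
      (integral_mono (hpi.sub hφi).abs (hφi.const_mul _) hpφ')
  have hNlow : M / 2 ≤ N := by nlinarith [(abs_le.1 hNM).1]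
  have hN : 0 < N := by linarith
  set b := M / N with hb
  have hb0 : 0 < b := by positivity
  have hb2 : b ≤ 2 := by rw [hb, div_le_iff₀ hN]; linarith
  have hb1 : |b - 1| ≤ 2 / M * |N - M| := by
    have : b - 1 = (M - N) / N := by rw [hb]; field_simp
    rw [this, abs_div, abs_of_pos hN, abs_sub_comm, div_eq_mul_inv, mul_comm]
    gcongr
    rw [inv_le_comm₀ hN (by positivity), inv_div]
    exact hNlow
  have hb1' : |b - 1| ≤ 2 * (τ * c₂) := hb1.trans <|
    calc 2 / M * |N - M| ≤ 2 / M * (τ * c₂ * M) := by gcongr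
      _ = _ := by field_simp
  have hg0 : ∀ x, 0 ≤ g x := fun x => (inv_pos.2 hc₄).le.trans (hgb x).1
  have hR := measurableSet_cube z l
  have hsplit : ∀ x, b * p x - φ x = b * (p x - φ x) + (b - 1) * φ x := fun x => by ring
  rw [withDensity_eq_of_restrict_eq hR hg hμ hφ (fun x => (hφ01 x).1)
      (fun x hx => hφz x (hDR x hx)),
    withDensity_eq_of_restrict_eq hR hg hμ (F := fun x => b * p x) (by fun_prop)
      (fun x => mul_nonneg hb0.le (hp01 x).1)
      (fun x hx => by simp [hz x (hDR x hx), hφz x (hDR x hx)])]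
  have hH : (fun x => ENNReal.ofReal (b * p x * g x)) =
      fun x => ENNReal.ofReal (φ x * g x + (b * p x - φ x) * g x) := by
    ext x; congr 1; ring
  rw [hH]
  have key := hC z l hl (fun x => φ x * g x) (fun x => (b * p x - φ x) * g x) (by fun_prop)
    (by fun_prop) ((c₂ * l ^ 2)⁻¹ * c₄⁻¹) (2 * τ * (1 + c₂ ^ 2) / l ^ 2 * c₄) (by positivity)
    (by positivity) ?_ ?_ ?_ ?_
  · refine key.trans ?_
    have hE : ∫⁻ x, ENNReal.ofReal (((b * p x - φ x) * g x) ^ 2 / D x ^ 2) ≤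
        ENNReal.ofReal (c₄ * (8 + 8 * c₂ ^ 2)) *
          ∫⁻ x, ENNReal.ofReal ((p x - φ x) ^ 2 / D x ^ 2) ∂μ := by
      calc _ ≤ ∫⁻ x, ENNReal.ofReal ((c₄ * ((b * p x - φ x) ^ 2 / D x ^ 2)) * g x) := by
            refine lintegral_mono fun x => ENNReal.ofReal_le_ofReal ?_
            have h1 : ((b * p x - φ x) * g x) ^ 2 / D x ^ 2 =
              (g x * ((b * p x - φ x) ^ 2 / D x ^ 2)) * g x := by ring
            rw [h1]
            gcongr
            · exact hg0 x
            · exact (hgb x).2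
        _ = ∫⁻ x, ENNReal.ofReal (c₄ * ((b * p x - φ x) ^ 2 / D x ^ 2)) ∂μ :=
            (lintegral_eq_of_restrict_eq hR hg hμ (by fun_prop) (fun x => by positivity)
              (fun x hx => by simp [hDR x hx])).symm
        _ ≤ ∫⁻ x, (ENNReal.ofReal (c₄ * 8) * ENNReal.ofReal ((p x - φ x) ^ 2 / D x ^ 2) +
              ENNReal.ofReal (c₄ * (2 * (b - 1) ^ 2 * (c₂ / l ^ 2))) * ENNReal.ofReal (φ x)) ∂μ := by
            refine lintegral_mono fun x => ?_
            rw [← ENNReal.ofReal_mul (by positivity), ← ENNReal.ofReal_mul (by positivity),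
              ← ENNReal.ofReal_add (by positivity)
                (mul_nonneg (by positivity) (hφ01 x).1)]
            refine ENNReal.ofReal_le_ofReal ?_
            rw [mul_assoc c₄ 8, mul_assoc c₄ (2 * _ * _), ← mul_add]
            gcongr
            rcases eq_or_ne (D x) 0 with hx | hx
            · simp [hx, hφz x hx]
            have hDx : 0 < D x ^ 2 := by positivity
            rw [div_le_iff₀ hDx, add_mul, ← mul_div_assoc, div_mul_cancel₀ _ hDx.ne', hsplit]
            have h3 : φ x ^ 2 ≤ c₂ / l ^ 2 * D x ^ 2 * φ x := by
              rw [sq]; exact mul_le_mul_of_nonneg_right (hφb x).2 (hφ01 x).1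
            have h4 : b ^ 2 ≤ 4 := by nlinarith
            have h5 := mul_le_mul_of_nonneg_right h4 (sq_nonneg (p x - φ x))
            have h6 := mul_le_mul_of_nonneg_left h3 (sq_nonneg (b - 1))
            nlinarith [sq_nonneg (b * (p x - φ x) - (b - 1) * φ x)]
        _ = ENNReal.ofReal (c₄ * 8) * ∫⁻ x, ENNReal.ofReal ((p x - φ x) ^ 2 / D x ^ 2) ∂μ +
              ENNReal.ofReal (c₄ * (2 * (b - 1) ^ 2 * (c₂ / l ^ 2))) * ENNReal.ofReal M := by
            rw [lintegral_add_left (by fun_prop), lintegral_const_mul _ (by fun_prop),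
              lintegral_const_mul _ (by fun_prop), hMdef,
              ofReal_integral_eq_lintegral_ofReal hφi (ae_of_all _ fun x => (hφ01 x).1)]
        _ ≤ ENNReal.ofReal (c₄ * 8) * ∫⁻ x, ENNReal.ofReal ((p x - φ x) ^ 2 / D x ^ 2) ∂μ +
              ENNReal.ofReal (c₄ * (8 * c₂ ^ 2)) *
                ∫⁻ x, ENNReal.ofReal ((p x - φ x) ^ 2 / D x ^ 2) ∂μ := by
            refine add_le_add le_rfl ?_
            have hsq := sq_integral_sub_le (μ := μ) hφ hp hDm hD0 hφ01 hp01
              (A := c₂ * l ^ 2) (by positivity) hDφ hz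
            rw [← hMdef, ← hNdef] at hsq
            have hbb : (b - 1) ^ 2 ≤ 4 / M ^ 2 * (N - M) ^ 2 := by
              rw [← sq_abs (b - 1), ← sq_abs (N - M)]
              calc |b - 1| ^ 2 ≤ (2 / M * |N - M|) ^ 2 := by gcongr
                _ = _ := by ring
            calc _ = ENNReal.ofReal (c₄ * (2 * (b - 1) ^ 2 * (c₂ / l ^ 2)) * M) :=
                  (ENNReal.ofReal_mul (by positivity)).symm
              _ ≤ ENNReal.ofReal (c₄ * (2 * (4 / M ^ 2 * (N - M) ^ 2) * (c₂ / l ^ 2)) * M) := by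
                  refine ENNReal.ofReal_le_ofReal ?_
                  gcongr
              _ = ENNReal.ofReal (8 * c₄ * c₂ / l ^ 2 / M) * ENNReal.ofReal ((N - M) ^ 2) := by
                  rw [← ENNReal.ofReal_mul (by positivity)]
                  congr 1
                  field_simp
                  ring
              _ ≤ _ := by
                  refine (mul_le_mul_right hsq _).trans (le_of_eq ?_)
                  rw [← mul_assoc, ← ENNReal.ofReal_mul (by positivity)]
                  congr 2
                  field_simp
        _ = _ := by
            rw [← add_mul, ← ENNReal.ofReal_add (by positivity) (by positivity)]
            congr 2
            ring
    refine (mul_le_mul_right hE _).trans (le_of_eq ?_)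
    have h7 : l ^ 2 / ((c₂ * l ^ 2)⁻¹ * c₄⁻¹) = c₂ * c₄ * l ^ 4 := by field_simp
    rw [h7, ENNReal.ofReal_mul (by positivity)]
    push_cast
    simp only [ENNReal.ofReal]
    ring
  · calc 2 * τ * (1 + c₂ ^ 2) / l ^ 2 * c₄
        = τ * (2 * (1 + c₂ ^ 2) * c₂ * c₄ ^ 2) * ((c₂ * l ^ 2)⁻¹ * c₄⁻¹) := by field_simp
      _ ≤ _ := by gcongr
  · intro x
    calc (c₂ * l ^ 2)⁻¹ * c₄⁻¹ * D x ^ 2 = (c₂ * l ^ 2)⁻¹ * D x ^ 2 * c₄⁻¹ := by ring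
      _ ≤ φ x * g x := mul_le_mul (hφb x).1 (hgb x).1 (by positivity) (hφ01 x).1
  · intro x
    rw [abs_mul, abs_of_nonneg (hg0 x)]
    calc |b * p x - φ x| * g x ≤ (2 * τ * (1 + c₂ ^ 2) / l ^ 2 * D x ^ 2) * c₄ := by
          refine mul_le_mul ?_ (hgb x).2 (hg0 x) (by positivity)
          rw [hsplit]
          refine (abs_add_le _ _).trans ?_
          rw [abs_mul, abs_mul, abs_of_pos hb0, abs_of_nonneg (hφ01 x).1]
          calc b * |p x - φ x| + |b - 1| * φ x
              ≤ 2 * (τ / l ^ 2 * D x ^ 2) + 2 * (τ * c₂) * (c₂ / l ^ 2 * D x ^ 2) := by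
                gcongr
                · exact hpφ x
                · exact (hφ01 x).1
                · exact (hφb x).2
            _ = _ := by ring
      _ = _ := by ring
  · rw [← integral_eq_of_restrict_eq hg hg0 hμ
      (fun x hx => by simp [hz x (hDR x hx), hφz x (hDR x hx)]),
      integral_sub (hpi.const_mul b) hφi, integral_const_mul]
    change b * N - M = 0
    rw [hb, div_mul_cancel₀ _ hN.ne', sub_self]

lemma edist_le_of_mem_cube {n : ℕ} {z x y : EuclideanSpace ℝ (Fin n)} {l : ℝ}
    (hx : x ∈ cube z l) (hy : y ∈ cube z l) :
    edist x y ≤ ENNReal.ofReal (√(n * l ^ 2)) := by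
  rw [edist_dist, EuclideanSpace.dist_eq]
  refine ENNReal.ofReal_le_ofReal (Real.sqrt_le_sqrt ?_)
  calc ∑ i, dist (x i) (y i) ^ 2 ≤ ∑ _i : Fin n, l ^ 2 := by
        refine Finset.sum_le_sum fun i _ => ?_
        have h1 := hx i
        have h2 := hy i
        refine pow_le_pow_left₀ dist_nonneg ?_ 2
        rw [Real.dist_eq, abs_le]
        constructor <;> linarith [h1.1, h1.2, h2.1, h2.2]
    _ = n * l ^ 2 := by simp

lemma innerDist_pos_of_mem_ocube {n : ℕ} [NeZero n] {z x : EuclideanSpace ℝ (Fin n)} {l : ℝ}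
    (hx : x ∈ ocube z l) : 0 < innerDist z l x := by
  refine lt_of_lt_of_le ?_ (le_max_left _ _)
  obtain ⟨i, hi⟩ := exists_eq_ciInf_of_finite (f := fun i => min (x i - z i) (z i + l - x i))
  rw [bdist, ← hi]
  exact lt_min (sub_pos.2 (hx i).1) (sub_pos.2 (hx i).2)

lemma memG.integral_pos {n : ℕ} [NeZero n] {c₂ : ℝ} (hc₂ : 0 < c₂)
    {z : EuclideanSpace ℝ (Fin n)} {l : ℝ} (hl : 0 < l) {φ : EuclideanSpace ℝ (Fin n) → ℝ}
    (h : memG c₂ z l φ) (μ : Measure (EuclideanSpace ℝ (Fin n))) [IsFiniteMeasure μ]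
    (hμ : 0 < μ (ocube z l)) : 0 < ∫ x, φ x ∂μ := by
  obtain ⟨K, hK⟩ := h.1
  have hi : Integrable φ μ := Integrable.of_bound hK.continuous.aestronglyMeasurable 1
    (ae_of_all _ fun y => by
      rw [Real.norm_eq_abs, abs_of_nonneg (h.2.1 _).1]; exact (h.2.1 _).2)
  rw [integral_pos_iff_support_of_nonneg (fun x => (h.2.1 x).1) hi]
  refine hμ.trans_le (measure_mono fun x hx => ?_)
  have h1 := innerDist_pos_of_mem_ocube hx
  exact (lt_of_lt_of_le (by positivity) (h.bounds x).1).ne'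

/-- If the second marginals of `π` and of its image agree on the set `G`, then the two weighted
measures share a large common part. -/
lemma transportCost_weighted_le {X : Type*} [EMetricSpace X] [MeasurableSpace X]
    [OpensMeasurableSpace X] {π : Measure (X × X)} [IsFiniteMeasure π] {G : Set (X × X)}
    (hG : MeasurableSet G) {S : X × X → X} (hS : Measurable S) (hSG : ∀ z ∈ G, S z = z.2)
    {φ : X → ℝ} (hφ : Measurable φ) (hφ01 : ∀ x, φ x ∈ Icc (0 : ℝ) 1) {R : Set X}
    (hφR : ∀ x ∉ R, φ x = 0) {K : ℝ≥0∞} (hK : ∀ x ∈ R, ∀ y ∈ R, edist x y ≤ K)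
    {a b : ℝ} (ha : 0 ≤ a) (hb : 0 ≤ b) (hb2 : b ≤ 2)
    (huniv : (π.map S).withDensity (fun x => ENNReal.ofReal (b * φ x)) univ =
      (π.map Prod.snd).withDensity (fun x => ENNReal.ofReal (a * φ x)) univ) :
    transportCost ((π.map S).withDensity fun x => ENNReal.ofReal (b * φ x))
        ((π.map Prod.snd).withDensity fun x => ENNReal.ofReal (a * φ x)) ≤
      K ^ 2 * (2 * (∫⁻ z in Gᶜ, ENNReal.ofReal (φ (S z)) ∂π +
        ∫⁻ z in Gᶜ, ENNReal.ofReal (φ z.2) ∂π)) := by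
  set ρ := (π.restrict G).map Prod.snd with hρ
  have hρS : ρ ≤ π.map S := by
    have : ρ = (π.restrict G).map S := by
      rw [hρ]
      refine Measure.map_congr ?_
      filter_upwards [ae_restrict_mem hG] with z hz
      exact (hSG z hz).symm
    rw [this]
    exact Measure.map_mono Measure.restrict_le_self hS
  have hρν : ρ ≤ π.map Prod.snd := Measure.map_mono Measure.restrict_le_self measurable_snd
  have hmono : ∀ {t : ℝ} {α : Measure X}, min a b ≤ t → ρ ≤ α →
      ρ.withDensity (fun x => ENNReal.ofReal (min a b * φ x)) ≤
        α.withDensity fun x => ENNReal.ofReal (t * φ x) := by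
    intro t α ht hα
    refine (withDensity_mono (ae_of_all _ fun x => ENNReal.ofReal_le_ofReal
      (mul_le_mul_of_nonneg_right ht (hφ01 x).1))).trans ?_
    refine Measure.le_iff.2 fun s hs => ?_
    rw [withDensity_apply _ hs, withDensity_apply _ hs]
    exact lintegral_mono' (Measure.restrict_mono le_rfl hα) le_rfl
  have hmass : ∀ {t : ℝ} {α : Measure X}, 0 ≤ t →
      α.withDensity (fun x => ENNReal.ofReal (t * φ x)) univ =
        ENNReal.ofReal t * ∫⁻ x, ENNReal.ofReal (φ x) ∂α := by
    intro t α ht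
    rw [withDensity_apply _ .univ, setLIntegral_univ, ← lintegral_const_mul _ (by fun_prop)]
    exact lintegral_congr fun x => ENNReal.ofReal_mul ht
  have hfin : ∀ {t : ℝ} {α : Measure X} [IsFiniteMeasure α], 0 ≤ t →
      IsFiniteMeasure (α.withDensity fun x => ENNReal.ofReal (t * φ x)) := by
    intro t α _ ht
    refine isFiniteMeasure_withDensity (ne_top_of_le_ne_top (b := ENNReal.ofReal t * α univ)
      (ENNReal.mul_ne_top ENNReal.ofReal_ne_top (measure_ne_top _ _)) ?_)
    rw [← lintegral_const]
    exact lintegral_mono fun x => ENNReal.ofReal_le_ofReal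
      (mul_le_of_le_one_right ht (hφ01 x).2)
  have hconc : ∀ {t : ℝ} {α : Measure X},
      ∀ᵐ x ∂α.withDensity (fun x => ENNReal.ofReal (t * φ x)), x ∈ R := by
    intro t α
    rw [ae_withDensity_iff (by fun_prop)]
    refine ae_of_all _ fun x hx => ?_
    by_contra h
    simp [hφR x h] at hx
  have := hfin (α := π.map S) hb
  have := hfin (α := π.map Prod.snd) ha
  refine (transportCost_le_of_common_part huniv (hmono (min_le_right a b) hρS)
    (hmono (min_le_left a b) hρν) hconc hconc hK).trans ?_
  gcongr
  set A := ∫⁻ z in G, ENNReal.ofReal (φ z.2) ∂π with hA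
  have hρA : ∫⁻ x, ENNReal.ofReal (φ x) ∂ρ = A := by
    rw [hρ, lintegral_map (by fun_prop) measurable_snd]
  have hSA : ∫⁻ x, ENNReal.ofReal (φ x) ∂(π.map S) =
      A + ∫⁻ z in Gᶜ, ENNReal.ofReal (φ (S z)) ∂π := by
    rw [lintegral_map (by fun_prop) hS, ← lintegral_add_compl _ hG, hA]
    congr 1
    exact setLIntegral_congr_fun hG fun z hz => by rw [hSG z hz]
  have hνA : ∫⁻ x, ENNReal.ofReal (φ x) ∂(π.map Prod.snd) =
      A + ∫⁻ z in Gᶜ, ENNReal.ofReal (φ z.2) ∂π := by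
    rw [lintegral_map (by fun_prop) measurable_snd, ← lintegral_add_compl _ hG]
  rw [tsub_le_iff_right, hmass (le_min ha hb), hρA]
  have htwo : ∀ {t : ℝ}, t ≤ 2 → ENNReal.ofReal t ≤ 2 := fun ht =>
    (ENNReal.ofReal_le_ofReal ht).trans (by simp)
  rcases le_total b a with hab | hab
  · rw [min_eq_right hab, hmass hb, hSA, mul_add, add_comm]
    gcongr
    · exact htwo hb2
    · exact le_self_add
  · rw [min_eq_left hab, huniv, hmass ha, hνA, mul_add, add_comm]
    gcongr
    · exact htwo (hab.trans hb2)
    · exact le_add_self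

set_option maxHeartbeats 1000000 in
/-- Localization of the quadratic transport cost, with a bound independent of the side length. -/
lemma transportCost_localize_le (n : ℕ) [NeZero n] {c₂ c₄ : ℝ} (hc₂ : 0 < c₂) (hc₄ : 0 < c₄) :
    ∃ C : ℝ≥0, C ≠ 0 ∧
      ∀ (μ ν : Measure (EuclideanSpace ℝ (Fin n))) [IsProbabilityMeasure μ]
        [IsProbabilityMeasure ν] (z : EuclideanSpace ℝ (Fin n)) (l : ℝ), 0 < l →
        0 < μ (ocube z l) → 0 < ν (ocube z l) →
      ∀ g : EuclideanSpace ℝ (Fin n) → ℝ, Measurable g → (∀ x, c₄⁻¹ ≤ g x ∧ g x ≤ c₄) →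
        μ.restrict (cube z l) =
          (volume.restrict (cube z l)).withDensity (fun y => ENNReal.ofReal (g y)) →
      ∀ φ : EuclideanSpace ℝ (Fin n) → ℝ, memG c₂ z l φ →
        transportCost (μ.withDensity fun y => ENNReal.ofReal (φ y))
          (ν.withDensity fun y => ENNReal.ofReal ((∫ w, φ w ∂μ) / (∫ w, φ w ∂ν) * φ y)) ≤
        C * transportCost μ ν := by
  obtain ⟨C, η, hη, hηc, hC⟩ := transportCost_reweight_le n hc₂ hc₄
  set ε := min 1 (η / (3 * c₂)) with hε
  have hε0 : 0 < ε := by positivity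
  have hε1 : ε ≤ 1 := min_le_left _ _
  have hεη : 3 * c₂ * ε ≤ η := by
    rw [mul_comm, ← le_div_iff₀ (by positivity)]
    exact min_le_right _ _
  refine ⟨2 * (9 * C * c₂.toNNReal ^ 2 + 2 * (2 + 4 * n * c₂.toNNReal *
    ((1 + 1 / ε) ^ 2).toNNReal)), by positivity, ?_⟩
  intro μ ν _ _ z l hl hμ0 hν0 g hg hgb hμ φ hφG
  refine le_mul_transportCost (by positivity) ENNReal.coe_ne_top fun π h1 h2 => ?_
  have hπ : IsProbabilityMeasure π := by
    constructor
    rw [← preimage_univ (f := Prod.fst), ← Measure.map_apply measurable_fst .univ, h1,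
      measure_univ]
  have hφ01 := hφG.2.1
  have hφ : Measurable φ := by
    obtain ⟨K, hK⟩ := hφG.1
    exact hK.continuous.measurable
  set D := innerDist z l with hDdef
  have hDm : Measurable D := (continuous_innerDist z l).measurable
  have hD0 : ∀ x, 0 ≤ D x := innerDist_nonneg z l
  have hφb := hφG.bounds
  have hφR : ∀ x ∉ cube z l, φ x = 0 := hφG.2.2.1
  set T := ∫⁻ z, edist z.1 z.2 ^ 2 ∂π with hT
  have hdT : ∀ r : ℝ, 0 ≤ r → ∀ A : Set (EuclideanSpace ℝ (Fin n) × EuclideanSpace ℝ (Fin n)),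
      ∫⁻ z in A, ENNReal.ofReal (r * dist z.1 z.2 ^ 2) ∂π ≤ ENNReal.ofReal r * T := by
    intro r hr A
    rw [hT, ← lintegral_const_mul _ (by fun_prop)]
    refine (setLIntegral_le_lintegral _ _).trans (lintegral_mono fun z => ?_)
    rw [ENNReal.ofReal_mul hr, ENNReal.ofReal_pow dist_nonneg, edist_dist]
  set G : Set (EuclideanSpace ℝ (Fin n) × EuclideanSpace ℝ (Fin n)) := {w | dist w.1 w.2 < ε * D w.1} with hGdef
  have hG : MeasurableSet G := measurableSet_lt (by fun_prop) (by fun_prop)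
  classical
  set S : EuclideanSpace ℝ (Fin n) × EuclideanSpace ℝ (Fin n) → EuclideanSpace ℝ (Fin n) := fun w => if w ∈ G then w.2 else w.1 with hSdef
  have hS : Measurable S := Measurable.ite hG measurable_snd measurable_fst
  have hSG : ∀ w ∈ G, S w = w.2 := fun w hw => if_pos hw
  have hSG' : ∀ w ∉ G, S w = w.1 := fun w hw => if_neg hw
  have hq : Measurable fun w => φ (S w) := hφ.comp hS
  obtain ⟨p, hp, hp01, hpmap, hpdev, hpvar⟩ := exists_fiber_average π hq fun w => hφ01 _
  rw [h1] at hpmap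
  -- the truncated displacement changes `φ` little
  have hdev : ∀ w, |φ (S w) - φ w.1| ≤ 3 * c₂ / l ^ 2 * D w.1 * dist w.1 w.2 ∧
      |φ (S w) - φ w.1| ≤ η / l ^ 2 * D w.1 ^ 2 := by
    intro w
    have hDw := hD0 w.1
    by_cases hw : w ∈ G
    · have hw' : dist w.1 w.2 < ε * D w.1 := hw
      rw [hSG w hw]
      have h3 : |φ w.2 - φ w.1| ≤ 3 * c₂ / l ^ 2 * D w.1 * dist w.1 w.2 :=
        calc |φ w.2 - φ w.1| ≤ c₂ / l ^ 2 * (D w.1 + 2 * dist w.1 w.2) * dist w.1 w.2 :=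
              hφG.abs_sub_le hc₂ _ _
          _ ≤ c₂ / l ^ 2 * (3 * D w.1) * dist w.1 w.2 := by
              gcongr
              linarith [mul_le_of_le_one_left hDw hε1]
          _ = _ := by ring
      refine ⟨h3, h3.trans ?_⟩
      calc _ ≤ 3 * c₂ / l ^ 2 * D w.1 * (ε * D w.1) := by gcongr
        _ = 3 * c₂ * ε / l ^ 2 * D w.1 ^ 2 := by ring
        _ ≤ _ := by gcongr
    · rw [hSG' w hw, sub_self, abs_zero]
      exact ⟨by positivity, by positivity⟩
  have hpφ : ∀ x, |p x - φ x| ≤ η / l ^ 2 * D x ^ 2 := fun x =>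
    hpdev x (φ x) _ fun y => (hdev (x, y)).2
  have hvar : ∫⁻ x, ENNReal.ofReal ((p x - φ x) ^ 2 / D x ^ 2) ∂μ ≤
      ENNReal.ofReal ((3 * c₂ / l ^ 2) ^ 2) * T := by
    have h3 := hpvar φ (fun x => ENNReal.ofReal ((D x ^ 2)⁻¹)) hφ (by fun_prop)
    rw [h1] at h3
    simp only [← ENNReal.ofReal_mul (sq_nonneg _), ← div_eq_mul_inv] at h3
    refine h3.trans (le_trans ?_ (hdT _ (sq_nonneg _) univ))
    rw [setLIntegral_univ]
    refine lintegral_mono fun w => ENNReal.ofReal_le_ofReal ?_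
    rcases eq_or_ne (D w.1) 0 with hw | hw
    · rw [hw]
      simp only [ne_eq, OfNat.ofNat_ne_zero, not_false_eq_true, zero_pow, _root_.div_zero]
      positivity
    · rw [div_le_iff₀ (by positivity), ← sq_abs]
      calc _ ≤ (3 * c₂ / l ^ 2 * D w.1 * dist w.1 w.2) ^ 2 := by gcongr; exact (hdev w).1
        _ = _ := by ring
  have hM : 0 < ∫ x, φ x ∂μ := hφG.integral_pos hc₂ hl μ hμ0
  have hN' : 0 < ∫ x, φ x ∂ν := hφG.integral_pos hc₂ hl ν hν0
  have hreweight := hC μ z l hl g hg hgb hμ φ p hφ hp hφ01 hp01 hφb hpφ hM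
  set M := ∫ x, φ x ∂μ with hMdef
  set N := ∫ x, p x ∂μ with hNdef
  have hφi : Integrable φ μ := Integrable.of_bound hφ.aestronglyMeasurable 1
    (ae_of_all _ fun y => by rw [Real.norm_eq_abs, abs_of_nonneg (hφ01 _).1]; exact (hφ01 _).2)
  have hφν : Integrable φ ν := Integrable.of_bound hφ.aestronglyMeasurable 1
    (ae_of_all _ fun y => by rw [Real.norm_eq_abs, abs_of_nonneg (hφ01 _).1]; exact (hφ01 _).2)
  have hpi : Integrable p μ := Integrable.of_bound hp.aestronglyMeasurable 1
    (ae_of_all _ fun y => by rw [Real.norm_eq_abs, abs_of_nonneg (hp01 _).1]; exact (hp01 _).2)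
  have hNlow : M / 2 ≤ N := by
    have h3 : |N - M| ≤ 1 / 2 * M := by
      rw [hMdef, hNdef, ← integral_sub hpi hφi, ← integral_const_mul]
      refine abs_integral_le_integral_abs.trans
        (integral_mono (hpi.sub hφi).abs (hφi.const_mul _) fun x => ?_)
      have h4 := (hφb x).1
      rw [inv_mul_le_iff₀ (by positivity)] at h4
      calc |p x - φ x| ≤ η / l ^ 2 * D x ^ 2 := hpφ x
        _ ≤ η / l ^ 2 * (c₂ * l ^ 2 * φ x) := by gcongr
        _ = η * c₂ * φ x := by field_simp
        _ ≤ _ := by gcongr; exact (hφ01 x).1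
    linarith [(abs_le.1 h3).1]
  have hN : 0 < N := by linarith
  set b := M / N with hb
  have hb0 : 0 < b := by positivity
  have hb2 : b ≤ 2 := by rw [hb, div_le_iff₀ hN]; linarith
  set a := M / ∫ x, φ x ∂ν with ha
  have ha0 : 0 < a := by positivity
  have hsmul : ∀ (ρ : Measure (EuclideanSpace ℝ (Fin n))) {t : ℝ} {F : EuclideanSpace ℝ (Fin n) → ℝ}, 0 ≤ t → Measurable F →
      ρ.withDensity (fun x => ENNReal.ofReal (t * F x)) =
        ENNReal.ofReal t • ρ.withDensity fun x => ENNReal.ofReal (F x) := by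
    intro ρ t F ht hF
    rw [← withDensity_smul _ (by fun_prop)]
    congr 1
    ext x
    exact ENNReal.ofReal_mul ht
  -- transporting the reweighted measure along the truncated displacement
  set κ := ENNReal.ofReal b • π.withDensity fun w => ENNReal.ofReal (φ (S w)) with hκ
  have hκ1 : κ.map Prod.fst = μ.withDensity fun x => ENNReal.ofReal (b * p x) := by
    rw [hκ, Measure.map_smul, hpmap, hsmul μ hb0.le hp]
  have hκ2 : κ.map S = (π.map S).withDensity fun x => ENNReal.ofReal (b * φ x) := by
    rw [hκ, Measure.map_smul,
      map_withDensity_comp π hS (g := fun x => ENNReal.ofReal (φ x)) (by fun_prop),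
      hsmul _ hb0.le hφ]
  have hκuniv : κ univ = ENNReal.ofReal M := by
    rw [← preimage_univ (f := Prod.fst), ← Measure.map_apply measurable_fst .univ, hκ1,
      hsmul _ hb0.le hp, Measure.smul_apply, withDensity_apply _ .univ, setLIntegral_univ,
      ← ofReal_integral_eq_lintegral_ofReal hpi (ae_of_all _ fun x => (hp01 x).1), smul_eq_mul,
      ← ENNReal.ofReal_mul hb0.le, ← hNdef, hb, div_mul_cancel₀ _ hN.ne']
  have hstep2 : transportCost (κ.map Prod.fst) (κ.map S) ≤ 2 * T := by
    have hm : Measurable fun w : EuclideanSpace ℝ (Fin n) × EuclideanSpace ℝ (Fin n) => (w.1, S w) := by fun_prop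
    refine (transportCost_le (κ.map fun w => (w.1, S w)) ?_ ?_).trans ?_
    · rw [Measure.map_map measurable_fst hm]; rfl
    · rw [Measure.map_map measurable_snd hm]; rfl
    · rw [lintegral_map (by fun_prop) hm, hκ, lintegral_smul_measure, smul_eq_mul]
      gcongr
      · exact (ENNReal.ofReal_le_ofReal hb2).trans (by simp)
      · rw [lintegral_withDensity_mul π (by fun_prop) (by fun_prop)]
        refine lintegral_mono fun w => ?_
        calc _ ≤ 1 * edist w.1 w.2 ^ 2 := by
              gcongr
              · exact ENNReal.ofReal_le_one.2 (hφ01 _).2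
              · by_cases hw : w ∈ G
                · rw [hSG w hw]
                · rw [hSG' w hw]; simp
          _ = _ := one_mul _
  have huniv : (π.map S).withDensity (fun x => ENNReal.ofReal (b * φ x)) univ =
      (π.map Prod.snd).withDensity (fun x => ENNReal.ofReal (a * φ x)) univ := by
    rw [← hκ2, Measure.map_apply hS .univ, preimage_univ, hκuniv, h2, hsmul _ ha0.le hφ,
      Measure.smul_apply, withDensity_apply _ .univ, setLIntegral_univ,
      ← ofReal_integral_eq_lintegral_ofReal hφν (ae_of_all _ fun x => (hφ01 x).1), smul_eq_mul,
      ← ENNReal.ofReal_mul ha0.le, ha, div_mul_cancel₀ _ hN'.ne']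
  have hstep3 := transportCost_weighted_le hG hS hSG hφ hφ01 hφR
    (fun x hx y hy => edist_le_of_mem_cube hx hy) ha0.le hb0.le hb2 huniv
  rw [h2, ← hκ2] at hstep3
  set L := c₂ / l ^ 2 * (1 + 1 / ε) ^ 2 with hL
  have hL0 : 0 ≤ L := by positivity
  have hfar : ∀ w ∉ G, φ w.1 ≤ L * dist w.1 w.2 ^ 2 ∧ φ w.2 ≤ L * dist w.1 w.2 ^ 2 := by
    intro w hw
    have hw' : D w.1 ≤ 1 / ε * dist w.1 w.2 := by
      rw [one_div, le_inv_mul_iff₀ hε0]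
      exact not_lt.1 hw
    have hw2 : D w.1 ≤ (1 + 1 / ε) * dist w.1 w.2 := by
      linarith [dist_nonneg (x := w.1) (y := w.2)]
    have hw3 : D w.2 ≤ (1 + 1 / ε) * dist w.1 w.2 := by
      linarith [innerDist_le_add_dist z l w.1 w.2]
    have hgen : ∀ x, D x ≤ (1 + 1 / ε) * dist w.1 w.2 → φ x ≤ L * dist w.1 w.2 ^ 2 := by
      intro x hx
      calc φ x ≤ c₂ / l ^ 2 * D x ^ 2 := (hφb x).2
        _ ≤ c₂ / l ^ 2 * ((1 + 1 / ε) * dist w.1 w.2) ^ 2 := by gcongr; exact hD0 x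
        _ = _ := by rw [hL]; ring
    exact ⟨hgen _ hw2, hgen _ hw3⟩
  have hB1 : ∫⁻ w in Gᶜ, ENNReal.ofReal (φ (S w)) ∂π ≤ ENNReal.ofReal L * T :=
    (setLIntegral_mono' hG.compl fun w hw => ENNReal.ofReal_le_ofReal
      (by rw [hSG' w hw]; exact (hfar w hw).1)).trans (hdT L hL0 Gᶜ)
  have hB2 : ∫⁻ w in Gᶜ, ENNReal.ofReal (φ w.2) ∂π ≤ ENNReal.ofReal L * T :=
    (setLIntegral_mono' hG.compl fun w hw => ENNReal.ofReal_le_ofReal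
      (hfar w hw).2).trans (hdT L hL0 Gᶜ)
  have : IsFiniteMeasure κ := ⟨by rw [hκuniv]; exact ENNReal.ofReal_lt_top⟩
  have : IsFiniteMeasure (μ.withDensity fun x => ENNReal.ofReal (b * p x)) := by
    rw [← hκ1]; infer_instance
  rw [hκ1] at hstep2
  have hone : transportCost (μ.withDensity fun x => ENNReal.ofReal (φ x))
      (μ.withDensity fun x => ENNReal.ofReal (b * p x)) ≤ 9 * C * c₂.toNNReal ^ 2 * T := by
    refine hreweight.trans ((mul_le_mul_right hvar _).trans (le_of_eq ?_))
    have h5 : ENNReal.ofReal (l ^ 4) * ENNReal.ofReal ((3 * c₂ / l ^ 2) ^ 2) =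
        9 * (c₂.toNNReal : ℝ≥0∞) ^ 2 := by
      rw [← ENNReal.ofReal_mul (by positivity)]
      have : l ^ 4 * (3 * c₂ / l ^ 2) ^ 2 = 9 * c₂ ^ 2 := by field_simp; norm_num
      rw [this, ENNReal.ofReal_mul (by norm_num), ENNReal.ofReal_pow hc₂.le]
      simp [ENNReal.ofReal]
    calc _ = C * (ENNReal.ofReal (l ^ 4) * ENNReal.ofReal ((3 * c₂ / l ^ 2) ^ 2)) * T := by ring
      _ = _ := by rw [h5]; ring
  have hthree : transportCost (κ.map S)
      (ν.withDensity fun x => ENNReal.ofReal (a * φ x)) ≤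
        4 * n * c₂.toNNReal * ((1 + 1 / ε) ^ 2).toNNReal * T := by
    refine hstep3.trans ((mul_le_mul_right (mul_le_mul_right (add_le_add hB1 hB2) _) _).trans
      (le_of_eq ?_))
    have h5 : ENNReal.ofReal (√(n * l ^ 2)) ^ 2 * ENNReal.ofReal L =
        n * c₂.toNNReal * ((1 + 1 / ε) ^ 2).toNNReal := by
      rw [← ENNReal.ofReal_pow (Real.sqrt_nonneg _), Real.sq_sqrt (by positivity),
        ← ENNReal.ofReal_mul (by positivity)]
      have : n * l ^ 2 * L = n * c₂ * (1 + 1 / ε) ^ 2 := by rw [hL]; field_simp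
      rw [this, ENNReal.ofReal_mul (by positivity), ENNReal.ofReal_mul (by positivity),
        ENNReal.ofReal_natCast]
      simp only [ENNReal.ofReal]
    calc _ = 4 * (ENNReal.ofReal (√(n * l ^ 2)) ^ 2 * ENNReal.ofReal L) * T := by ring
      _ = _ := by rw [h5]; ring
  refine (transportCost_triangle _ (μ.withDensity fun x => ENNReal.ofReal (b * p x)) _).trans ?_
  have hfinS : IsFiniteMeasure (κ.map S) := inferInstance
  have hrest := transportCost_triangle (μ.withDensity fun x => ENNReal.ofReal (b * p x))
    (κ.map S) (ν.withDensity fun x => ENNReal.ofReal (a * φ x))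
  calc _ ≤ 2 * (9 * C * (c₂.toNNReal : ℝ≥0∞) ^ 2 * T + 2 * (2 * T +
        4 * n * c₂.toNNReal * ((1 + 1 / ε) ^ 2).toNNReal * T)) := by
        gcongr
        exact hrest.trans (by gcongr)
    _ = _ := by
        push_cast
        ring

/-- Theorem 3.3, localization of `W₂` on a cube.
If `μ, ν` are probability measures on `ℝⁿ` with finite second moments, `R` is a closed cube
with side length `ℓ(R) ≥ c₅` with `μ(int R), ν(int R) > 0`, `μ⌊R = f dx` with
`c₄⁻¹ ≤ f ≤ c₄` a.e. on `R`, and `φ ∈ 𝒢(R)` (with constant `c₂`), then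
`W₂(φμ, a φν) ≤ c W₂(μ,ν)`, where `a = (∫φ dμ)/(∫φ dν)` and `c = c(n, c₂, c₄, c₅)`. -/
theorem statement4 (n : ℕ) (c₂ c₄ c₅ : ℝ) (hc₂ : 0 < c₂) (hc₄ : 0 < c₄) (hc₅ : 0 < c₅) :
    ∃ c : ℝ, 0 < c ∧
      ∀ (μ ν : Measure (EuclideanSpace ℝ (Fin n))),
        IsProbabilityMeasure μ → IsProbabilityMeasure ν →
        (∫⁻ x, (‖x‖₊ : ℝ≥0∞) ^ 2 ∂μ) < ⊤ → (∫⁻ x, (‖x‖₊ : ℝ≥0∞) ^ 2 ∂ν) < ⊤ →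
        ∀ (z : EuclideanSpace ℝ (Fin n)) (l : ℝ), c₅ ≤ l →
        0 < μ (ocube z l) → 0 < ν (ocube z l) →
        ∀ f : EuclideanSpace ℝ (Fin n) → ℝ,
          μ.restrict (cube z l) =
            (volume.restrict (cube z l)).withDensity (fun y => ENNReal.ofReal (f y)) →
          (∀ᵐ y ∂(volume.restrict (cube z l)), c₄⁻¹ ≤ f y ∧ f y ≤ c₄) →
        ∀ φ : EuclideanSpace ℝ (Fin n) → ℝ, memG c₂ z l φ →
          Wp 2 (μ.withDensity fun y => ENNReal.ofReal (φ y))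
              (ν.withDensity fun y =>
                ENNReal.ofReal ((∫ w, φ w ∂μ) / (∫ w, φ w ∂ν) * φ y)) ≤
            ENNReal.ofReal c * Wp 2 μ ν := by
  rcases Nat.eq_zero_or_pos n with rfl | hn
  · refine ⟨1, one_pos, fun μ ν _ _ _ _ z l _ _ _ f _ _ φ hφ => ?_⟩
    have h0 : ∀ x, φ x = 0 := fun x => by
      have hx : x ∈ cube z l := fun i => i.elim0
      have hb : bdist z l x = 0 := Real.iInf_of_isEmpty _
      have h := hφ.2.2.2.1 x hx
      rw [hb] at h
      exact le_antisymm (by simpa using h.2) (hφ.2.1 x).1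
    simp [h0, Wp_two_eq, transportCost_self]
  have : NeZero n := ⟨hn.ne'⟩
  obtain ⟨C, hC0, hC⟩ := transportCost_localize_le n hc₂ hc₄
  refine ⟨√C, Real.sqrt_pos.2 (by positivity), ?_⟩
  intro μ ν _ _ _ _ z l hl hμ0 hν0 f hf hfb φ hφ
  have hl0 : 0 < l := hc₅.trans_le hl
  have hvol := volume_cube z hl0
  have : IsFiniteMeasure (volume.restrict (cube z l)) :=
    ⟨by rw [Measure.restrict_apply_univ, hvol]; exact ENNReal.ofReal_lt_top⟩
  have : NeZero (volume.restrict (cube z l)) := ⟨by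
    rw [Ne, Measure.restrict_eq_zero, hvol, ENNReal.ofReal_eq_zero, not_le]
    positivity⟩
  obtain ⟨y, hy⟩ := hfb.exists
  obtain ⟨g, hg, hgb, hgμ⟩ := exists_measurable_density_of_bounds (hy.1.trans hy.2) hf hfb
  have h := hC μ ν z l hl0 hμ0 hν0 g hg hgb hgμ φ hφ
  rw [Wp_two_eq, Wp_two_eq]
  refine (ENNReal.rpow_le_rpow h (by norm_num)).trans (le_of_eq ?_)
  rw [ENNReal.mul_rpow_of_nonneg _ _ (by norm_num), Real.sqrt_eq_rpow,
    ← ENNReal.ofReal_rpow_of_nonneg (by positivity) (by norm_num), ENNReal.ofReal_coe_nnreal]
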